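/- arXiv:1708.06538 — 6 statements merged into one kernel-verified Lean document; each statement's English description precedes it below -/
import Mathlib

section
/- Let K be a chain complex of free abelian groups with differentials ∂_n : K_n → K_{n-1}, and let A be a divisible abelian group. Write Z^n(K,A) = {f : K_n → A additive | f ∘ ∂_{n+1} = 0} and B^n(K,A) = {g ∘ ∂_n | g : K_{n-1} → A additive}. Then the map sending the class of a cocycle f ∈ Z^n(K,A) to the homomorphism H_n(K) → A induced by the restriction of f to the n-cycles is a group isomorphism Z^n(K,A)/B^n(K,A) ≅ Hom_ℤ(H_n(K), A). -/
/-- The group of `n`-cocycles on the (three-term segment of the) chain complex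
`Kp --d1--> K0 --d0--> Km` with values in `A`: additive maps `f : K0 →+ A`
with `f ∘ d1 = 0`. -/
def cocycleGroup {Kp K0 A : Type} [AddCommGroup Kp] [AddCommGroup K0]
    [AddCommGroup A] (d1 : Kp →+ K0) : AddSubgroup (K0 →+ A) where
  carrier := {f | f.comp d1 = 0}
  add_mem' := by
    intro f g hf hg
    simp only [Set.mem_setOf_eq] at *
    ext x
    simp [AddMonoidHom.ext_iff] at hf hg ⊢
    simp [hf x, hg x]
  zero_mem' := by
    ext x; simp
  neg_mem' := by
    intro f hf
    simp only [Set.mem_setOf_eq] at *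
    ext x
    simp [AddMonoidHom.ext_iff] at hf ⊢
    simp [hf x]

/-- The group of `n`-coboundaries: additive maps `K0 →+ A` of the form
`g ∘ d0` for some `g : Km →+ A`, where `d0 : K0 →+ Km` is the `n`-th
differential. -/
def coboundaryGroup {K0 Km A : Type} [AddCommGroup K0] [AddCommGroup Km]
    [AddCommGroup A] (d0 : K0 →+ Km) : AddSubgroup (K0 →+ A) where
  carrier := {f | ∃ g : Km →+ A, f = g.comp d0}
  add_mem' := by
    rintro f f' ⟨g, rfl⟩ ⟨g', rfl⟩
    exact ⟨g + g', by ext x; simp⟩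
  zero_mem' := ⟨0, by ext x; simp⟩
  neg_mem' := by
    rintro f ⟨g, rfl⟩
    exact ⟨-g, by ext x; simp⟩

/-- Restriction of a cocycle to the cycles, as a homomorphism on homology. -/
def cocycleToHom {Kp K0 Km A : Type} [AddCommGroup Kp] [AddCommGroup K0] [AddCommGroup Km]
    [AddCommGroup A] (d1 : Kp →+ K0) (d0 : K0 →+ Km) :
    cocycleGroup (A := A) d1 →+ ((d0.ker ⧸ d1.range.addSubgroupOf d0.ker) →+ A) where
  toFun f := QuotientAddGroup.lift _ (f.1.comp d0.ker.subtype) (by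
    rintro ⟨z, hz⟩ hz'
    obtain ⟨x, rfl⟩ := AddSubgroup.mem_addSubgroupOf.1 hz'
    exact DFunLike.congr_fun f.2 x)
  map_zero' := by
    ext z
    rfl
  map_add' f g := by
    ext z
    rfl

/-- **Universal Coefficient Theorem, divisible coefficients.**
Let `K` be a chain complex of free abelian groups (of which only the segment
`Kp --d1--> K0 --d0--> Km` around degree `n` matters, `d1 = ∂_{n+1}`,
`d0 = ∂_n`), and let `A` be a divisible abelian group.  Then the map sending
the class of a cocycle `f ∈ Z^n(K,A)` to the homomorphism `H_n(K) → A`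
induced by restricting `f` to the `n`-cycles is a group isomorphism
`Z^n(K,A)/B^n(K,A) ≅ Hom_ℤ(H_n(K), A)`. -/
theorem universalCoefficients_divisible
    (Kp K0 Km : Type) [AddCommGroup Kp] [AddCommGroup K0] [AddCommGroup Km]
    [Module.Free ℤ Kp] [Module.Free ℤ K0] [Module.Free ℤ Km]
    (d1 : Kp →+ K0) (d0 : K0 →+ Km) (hdd : ∀ x, d0 (d1 x) = 0)
    (A : Type) [AddCommGroup A] [DivisibleBy A ℤ] :
    ∃ Φ : (cocycleGroup (A := A) d1 ⧸
            (coboundaryGroup d0).addSubgroupOf (cocycleGroup (A := A) d1)) ≃+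
          ((d0.ker ⧸ d1.range.addSubgroupOf d0.ker) →+ A),
      ∀ (f : K0 →+ A) (hf : f ∈ cocycleGroup (A := A) d1)
        (z : K0) (hz : z ∈ d0.ker),
        Φ (QuotientAddGroup.mk ⟨f, hf⟩) (QuotientAddGroup.mk ⟨z, hz⟩) = f z := by
  have hB : Module.Baer ℤ A := Module.Baer.of_divisible A
  have hker : (coboundaryGroup d0).addSubgroupOf (cocycleGroup (A := A) d1) =
      (cocycleToHom (A := A) d1 d0).ker := by
    ext ⟨f, hf⟩
    rw [AddSubgroup.mem_addSubgroupOf, AddMonoidHom.mem_ker]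
    constructor
    · rintro ⟨g, hg⟩
      change f = g.comp d0 at hg
      subst hg
      ext ⟨z, hz⟩
      change g (d0 z) = 0
      rw [AddMonoidHom.mem_ker.1 hz, map_zero]
    · intro h
      have hz : ∀ z ∈ d0.ker, f z = 0 := by
        intro z hz
        have h2 := DFunLike.congr_fun h
          (QuotientAddGroup.mk' (d1.range.addSubgroupOf d0.ker) ⟨z, hz⟩)
        exact h2
      obtain ⟨g, hg⟩ := hB.extension_property_addMonoidHom
        (QuotientAddGroup.kerLift d0) (QuotientAddGroup.kerLift_injective d0)
        (QuotientAddGroup.lift d0.ker f hz)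
      refine ⟨g, ?_⟩
      ext x
      exact (DFunLike.congr_fun hg (QuotientAddGroup.mk x)).symm
  have hsurj : Function.Surjective (cocycleToHom (A := A) d1 d0) := by
    intro φ
    obtain ⟨f, hf⟩ := hB.extension_property_addMonoidHom d0.ker.subtype
      Subtype.val_injective (φ.comp (QuotientAddGroup.mk' _))
    have hfz : ∀ z (hz : z ∈ d0.ker), f z = φ (QuotientAddGroup.mk ⟨z, hz⟩) :=
      fun z hz => DFunLike.congr_fun hf ⟨z, hz⟩
    refine ⟨⟨f, ?_⟩, ?_⟩
    · change f.comp d1 = 0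
      ext x
      change f (d1 x) = 0
      rw [hfz (d1 x) (hdd x), (QuotientAddGroup.eq_zero_iff _).2, map_zero]
      exact AddSubgroup.mem_addSubgroupOf.2 ⟨x, rfl⟩
    · ext ⟨z, hz⟩
      exact hfz z hz
  exact ⟨(QuotientAddGroup.quotientAddEquivOfEq hker).trans
    (QuotientAddGroup.quotientKerEquivOfSurjective _ hsurj), fun f hf z hz => rfl⟩
end

section
/- Let K be a chain complex of free abelian groups with differentials ∂_n : K_n → K_{n-1}, and let A be any abelian group. Write Z^n(K,A) = {f : K_n → A additive | f ∘ ∂_{n+1} = 0} and B^n(K,A) = {g ∘ ∂_n | g : K_{n-1} → A additive}. Then the map α_A : Z^n(K,A)/B^n(K,A) → Hom_ℤ(H_n(K), A), sending the class of a cocycle f to the homomorphism H_n(K) → A induced by restricting f to the n-cycles, is a well-defined surjective group homomorphism and admits a group-homomorphism section π_A (that is, α_A ∘ π_A = id). -/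
/-- The cycles are a direct summand: there is a retraction of `K0` onto `ker d0`.
The group `K0` embeds in a rational vector space `E`, and `E / ker d0` is divisible, hence
injective; the induced map from the image of `d0` extends to `Km` and lifts to `E`. -/
theorem exists_ker_retraction {K0 Km : Type} [AddCommGroup K0] [AddCommGroup Km]
    [Module.Free ℤ K0] [Module.Free ℤ Km] (d0 : K0 →+ Km) :
    ∃ r : K0 →+ d0.ker, ∀ z : d0.ker, r z = z := by
  classical
  let b := Module.Free.chooseBasis ℤ K0
  let e : K0 →+ (Module.Free.ChooseBasisIndex ℤ K0 → ℚ) :=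
    { toFun := fun x i => (b.repr x i : ℚ)
      map_zero' := by ext i; simp
      map_add' := fun x y => by ext i; simp }
  have he : Function.Injective e := by
    intro x y hxy
    apply b.repr.injective
    ext i
    have h : (b.repr x i : ℚ) = (b.repr y i : ℚ) := congrFun hxy i
    exact_mod_cast h
  let W := d0.ker.map e
  let q : (Module.Free.ChooseBasisIndex ℤ K0 → ℚ) →+ _ ⧸ W := QuotientAddGroup.mk' W
  have hq : Function.Surjective q := QuotientAddGroup.mk'_surjective W
  letI : DivisibleBy ((Module.Free.ChooseBasisIndex ℤ K0 → ℚ) ⧸ W) ℤ :=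
    divisibleByOfSMulRightSurj _ _ (by
      intro n hn y
      obtain ⟨v, rfl⟩ := hq y
      refine ⟨q (fun i => v i / n), ?_⟩
      change n • q _ = _
      rw [← map_zsmul]
      congr 1
      ext i
      have : (n : ℚ) ≠ 0 := by exact_mod_cast hn
      simp
      field_simp)
  obtain ⟨g, hg⟩ := (Module.Baer.of_divisible
      ((Module.Free.ChooseBasisIndex ℤ K0 → ℚ) ⧸ W)).extension_property_addMonoidHom
    (QuotientAddGroup.kerLift d0) (QuotientAddGroup.kerLift_injective d0)
    (QuotientAddGroup.lift d0.ker (q.comp e) (fun z hz =>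
      (QuotientAddGroup.eq_zero_iff _).2 ⟨z, hz, rfl⟩))
  have hg' : ∀ x, g (d0 x) = q (e x) := fun x =>
    DFunLike.congr_fun hg (QuotientAddGroup.mk x)
  obtain ⟨h, hh⟩ := Module.projective_lifting_property q.toIntLinearMap g.toIntLinearMap hq
  have hh' : ∀ y, q (h y) = g y := fun y => LinearMap.congr_fun hh y
  have key : ∀ x, ∃ z : d0.ker, e z = e x - h (d0 x) := by
    intro x
    have hx : q (e x - h (d0 x)) = 0 := by rw [map_sub, hh', hg', sub_self]
    obtain ⟨z, hz, hzx⟩ := (QuotientAddGroup.eq_zero_iff _).1 hx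
    exact ⟨⟨z, hz⟩, hzx⟩
  choose r hr using key
  refine ⟨AddMonoidHom.mk' r ?_, ?_⟩
  · intro x y
    apply Subtype.ext
    apply he
    rw [AddSubgroup.coe_add, map_add, hr, hr, hr]
    simp only [map_add]
    abel
  · intro z
    apply Subtype.ext
    apply he
    have hz : d0 z = 0 := z.2
    rw [AddMonoidHom.mk'_apply, hr, hz, map_zero, sub_zero]

/-- **Universal Coefficient Theorem, arbitrary coefficients: the evaluation map
and its splitting.**  Let `K` be a chain complex of free abelian groups (of
which only the segment `Kp --d1--> K0 --d0--> Km` around degree `n` matters,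
`d1 = ∂_{n+1}`, `d0 = ∂_n`), and let `A` be any abelian group.  Then the map
`α_A : Z^n(K,A)/B^n(K,A) → Hom_ℤ(H_n(K), A)`, sending the class of a cocycle
`f` to the homomorphism `H_n(K) → A` induced by restricting `f` to the
`n`-cycles, is a well-defined surjective group homomorphism admitting a
group-homomorphism section `π_A` with `α_A ∘ π_A = id`. -/
theorem universalCoefficients_surjection_section
    (Kp K0 Km : Type) [AddCommGroup Kp] [AddCommGroup K0] [AddCommGroup Km]
    [Module.Free ℤ Kp] [Module.Free ℤ K0] [Module.Free ℤ Km]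
    (d1 : Kp →+ K0) (d0 : K0 →+ Km) (hdd : ∀ x, d0 (d1 x) = 0)
    (A : Type) [AddCommGroup A] :
    ∃ (α : (cocycleGroup (A := A) d1 ⧸
            (coboundaryGroup d0).addSubgroupOf (cocycleGroup (A := A) d1)) →+
          ((d0.ker ⧸ d1.range.addSubgroupOf d0.ker) →+ A))
      (π : ((d0.ker ⧸ d1.range.addSubgroupOf d0.ker) →+ A) →+
          (cocycleGroup (A := A) d1 ⧸
            (coboundaryGroup d0).addSubgroupOf (cocycleGroup (A := A) d1))),
      (∀ (f : K0 →+ A) (hf : f ∈ cocycleGroup (A := A) d1)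
        (z : K0) (hz : z ∈ d0.ker),
        α (QuotientAddGroup.mk ⟨f, hf⟩) (QuotientAddGroup.mk ⟨z, hz⟩) = f z) ∧
      Function.Surjective α ∧
      α.comp π = AddMonoidHom.id _ := by
  classical
  obtain ⟨r, hr⟩ := exists_ker_retraction d0
  let ev : cocycleGroup (A := A) d1 →+ ((d0.ker ⧸ d1.range.addSubgroupOf d0.ker) →+ A) :=
    { toFun := fun f => QuotientAddGroup.lift _ (f.1.comp d0.ker.subtype) (by
        rintro ⟨z, hz⟩ ⟨x, hx⟩
        have hx' : d1 x = z := hx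
        subst hx'
        exact DFunLike.congr_fun f.2 x)
      map_zero' := by
        ext z
        rfl
      map_add' := fun f g => by
        ext z
        rfl }
  let α := QuotientAddGroup.lift
    ((coboundaryGroup d0).addSubgroupOf (cocycleGroup (A := A) d1)) ev (by
      rintro ⟨f, hf⟩ ⟨g, hg⟩
      have hg' : f = g.comp d0 := hg
      subst hg'
      ext ⟨z, hz⟩
      have hz' : d0 z = 0 := hz
      change g (d0 z) = 0
      rw [hz', map_zero])
  let q : d0.ker →+ (d0.ker ⧸ d1.range.addSubgroupOf d0.ker) := QuotientAddGroup.mk' _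
  let p : ((d0.ker ⧸ d1.range.addSubgroupOf d0.ker) →+ A) →+ cocycleGroup (A := A) d1 :=
    { toFun := fun φ => ⟨φ.comp (q.comp r), by
        change (φ.comp (q.comp r)).comp d1 = 0
        ext x
        have h1 : r (d1 x) = ⟨d1 x, hdd x⟩ := hr ⟨d1 x, hdd x⟩
        have h2 : q ⟨d1 x, hdd x⟩ = 0 :=
          (QuotientAddGroup.eq_zero_iff _).2 ⟨x, rfl⟩
        simp [h1, h2]⟩
      map_zero' := by
        apply Subtype.ext
        ext z
        rfl
      map_add' := fun f g => by
        apply Subtype.ext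
        ext z
        rfl }
  have hsec : ∀ φ, α ((QuotientAddGroup.mk' _).comp p φ) = φ := by
    intro φ
    ext z
    change φ (q (r z)) = φ (q z)
    rw [hr]
  exact ⟨α, (QuotientAddGroup.mk' _).comp p, fun f hf z hz => rfl,
    fun φ => ⟨_, hsec φ⟩, AddMonoidHom.ext hsec⟩
end

section
/- The group cohomology H^3(ℤ/4ℤ × ℤ/2ℤ, ℂ^×) with coefficients in the trivial module ℂ^× is isomorphic as an abelian group to ℤ/4ℤ × ℤ/2ℤ × ℤ/2ℤ. -/
namespace HThree

open CategoryTheory groupCohomology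

abbrev A : Type := Additive ℂˣ
abbrev G : Type := Multiplicative (ZMod 4 × ZMod 2)

noncomputable def iU : ℂˣ := Units.mk0 Complex.I Complex.I_ne_zero

noncomputable def ev : ZMod 4 →+ A :=
  ZMod.lift 4 ⟨(zmultiplesHom A) (Additive.ofMul iU), by
    have : iU ^ 4 = 1 := by ext; simp [iU]
    simp only [zmultiplesHom_apply]
    rw [← ofMul_zpow, ofMul_eq_zero]
    exact_mod_cast this⟩

lemma ev_natCast (n : ℕ) : ev (n : ZMod 4) = Additive.ofMul (iU ^ n) := by
  have := ZMod.lift_coe 4 ⟨(zmultiplesHom A) (Additive.ofMul iU), by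
    have : iU ^ 4 = 1 := by ext; simp [iU]
    simp only [zmultiplesHom_apply]
    rw [← ofMul_zpow, ofMul_eq_zero]
    exact_mod_cast this⟩ (n : ℤ)
  simpa [ev] using this

lemma ev_inj (x : ZMod 4) (h : ev x = 0) : x = 0 := by
  obtain ⟨n, hn, rfl⟩ : ∃ n : ℕ, n < 4 ∧ (n : ZMod 4) = x := ⟨x.val, x.val_lt, by simp⟩
  rw [ev_natCast, ofMul_eq_zero] at h
  have h := congrArg (fun u : ℂˣ => (u : ℂ)) h
  simp [iU] at h
  interval_cases n
  · rfl
  · exact absurd (congrArg Complex.im h) (by simp)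
  · exact absurd (congrArg Complex.re h) (by norm_num)
  · exact absurd (congrArg Complex.im h) (by norm_num)

lemma ev_surj (a : A) (h : 4 • a = 0) : ∃ x : ZMod 4, ev x = a := by
  obtain ⟨u, rfl⟩ := Additive.ofMul.surjective a
  have h1 : (u : ℂ) ^ 4 = 1 := by
    have h' : u ^ 4 = 1 := h
    rw [← Units.val_pow_eq_pow_val, h', Units.val_one]
  have h2 : ((u : ℂ) - 1) * ((u - Complex.I) * ((u + 1) * (u + Complex.I))) = 0 := by
    have := Complex.I_sq
    linear_combination h1 + (1 - (u:ℂ)^2) * this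
  have key : ∃ n : ℕ, (u : ℂ) = Complex.I ^ n := by
    rcases mul_eq_zero.1 h2 with h | h
    · exact ⟨0, by linear_combination h⟩
    rcases mul_eq_zero.1 h with h | h
    · exact ⟨1, by linear_combination h⟩
    rcases mul_eq_zero.1 h with h | h
    · exact ⟨2, by rw [Complex.I_sq]; linear_combination h⟩
    · exact ⟨3, by rw [Complex.I_pow_three]; linear_combination h⟩
  obtain ⟨n, hn⟩ := key
  refine ⟨n, ?_⟩
  rw [ev_natCast]
  congr 1
  ext
  simp [iU, hn]

lemma card_mid {X Y Z : Type*} [AddCommGroup X] [AddCommGroup Y] [AddCommGroup Z]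
    [Finite X] [Finite Z] (f : X →+ Y) (g : Y →+ Z) (h : ∀ y, g y = 0 → ∃ x, f x = y)
    {m n : ℕ} (hX : Nat.card X ≤ m) (hZ : Nat.card Z ≤ n) :
    Finite Y ∧ Nat.card Y ≤ m * n := by
  have h1 := AddSubgroup.card_eq_card_quotient_mul_card_addSubgroup g.ker
  have hle : g.ker ≤ f.range := fun y hy => h y hy
  have : Finite f.range := Finite.of_surjective f.rangeRestrict f.rangeRestrict_surjective
  have fk : Finite g.ker := Finite.of_injective (AddSubgroup.inclusion hle) (AddSubgroup.inclusion_injective hle)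
  have c1 : Nat.card g.ker ≤ m := (Nat.card_le_card_of_injective _ (AddSubgroup.inclusion_injective hle)).trans
    ((Nat.card_le_card_of_surjective _ f.rangeRestrict_surjective).trans hX)
  have e := QuotientAddGroup.quotientKerEquivRange g
  have fq : Finite (Y ⧸ g.ker) := Finite.of_equiv _ e.symm.toEquiv
  have c2 : Nat.card (Y ⧸ g.ker) ≤ n := by
    rw [Nat.card_congr e.toEquiv]
    exact (Nat.card_le_card_of_injective _ Subtype.val_injective).trans hZ
  constructor
  · apply Nat.finite_of_card_ne_zero
    rw [h1]
    exact mul_ne_zero Nat.card_pos.ne' Nat.card_pos.ne'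
  · rw [h1, mul_comm m]; exact Nat.mul_le_mul c2 c1

def K : Subgroup G where
  carrier := {g | g.toAdd.2 = 0}
  mul_mem' := by intro a b ha hb; simp_all
  one_mem' := by simp
  inv_mem' := by intro a ha; simp_all

noncomputable instance : Fintype K := Fintype.ofFinite K

def gK : K := ⟨Multiplicative.ofAdd (1, 0), rfl⟩

lemma gK_gen (x : K) : x ∈ Subgroup.zpowers gK := by
  obtain ⟨x, hx⟩ := x
  refine Subgroup.mem_zpowers_iff.2 ⟨(x.toAdd.1.val : ℤ), ?_⟩
  apply Subtype.ext
  have hx : x.toAdd.2 = 0 := hx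
  simp only [gK, zpow_natCast]
  apply Multiplicative.toAdd.injective
  apply Prod.ext <;> simp [hx]

lemma card_K : Fintype.card K = 4 := by
  have e : K ≃ ZMod 4 :=
   { toFun := fun x => x.1.toAdd.1
     invFun := fun a => ⟨Multiplicative.ofAdd (a, 0), rfl⟩
     left_inv := by
       rintro ⟨x, hx⟩
       apply Subtype.ext
       apply Multiplicative.toAdd.injective
       exact Prod.ext rfl (Eq.symm hx)
     right_inv := fun a => rfl }
  rw [Fintype.card_congr e, ZMod.card]

noncomputable abbrev AK : Rep ℤ K := Rep.trivial ℤ K A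
noncomputable abbrev AG : Rep ℤ G := Rep.trivial ℤ G A

lemma norm_AK (a : A) : AK.norm.hom a = 4 • a := by
  simp [Rep.norm, Representation.norm, card_K]

lemma H2K : Limits.IsZero (groupCohomology AK 2) := by
  rw [ModuleCat.isZero_iff_subsingleton]
  have hs : Function.Surjective (Rep.FiniteCyclicGroup.groupCohomologyπEven AK gK gK_gen 2 even_two) :=
    by
    refine (ModuleCat.epi_iff_surjective _).1 ?_
    refine @epi_comp _ _ _ _ _ _ ?_ _ ?_
    · exact @IsIso.epi_of_iso _ _ _ _ _ (Iso.isIso_inv _)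
    · refine @epi_comp _ _ _ _ _ _ ?_ _ ?_
      · infer_instance
      · infer_instance
  refine subsingleton_of_forall_eq 0 fun y => ?_
  obtain ⟨x, rfl⟩ := hs y
  rw [Rep.FiniteCyclicGroup.groupCohomologyπEven_eq_zero_iff]
  obtain ⟨x, hx⟩ := x
  obtain ⟨u, rfl⟩ : ∃ u : ℂˣ, Additive.ofMul u = x := Additive.ofMul.surjective x
  obtain ⟨z, hz⟩ := IsAlgClosed.exists_pow_nat_eq (u : ℂ) (show 0 < 4 by norm_num)
  have hz0 : z ≠ 0 := by rintro rfl; simp at hz; exact u.ne_zero hz.symm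
  refine ⟨Additive.ofMul (Units.mk0 z hz0), ?_⟩
  refine (norm_AK _).trans ?_
  show Additive.ofMul ((Units.mk0 z hz0) ^ 4) = Additive.ofMul u
  refine congrArg Additive.ofMul ?_
  ext
  simpa using hz

lemma H3K : Finite (groupCohomology AK 3) ∧ Nat.card (groupCohomology AK 3) ≤ 4 := by
  have hs : Function.Surjective (Rep.FiniteCyclicGroup.groupCohomologyπOdd AK gK gK_gen 3 (by decide)) :=
    by
    refine (ModuleCat.epi_iff_surjective _).1 ?_
    refine @epi_comp _ _ _ _ _ _ ?_ _ ?_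
    · exact @IsIso.epi_of_iso _ _ _ _ _ (Iso.isIso_inv _)
    · refine @epi_comp _ _ _ _ _ _ ?_ _ ?_
      · infer_instance
      · infer_instance
  have hm (x : ZMod 4) : ev x ∈ LinearMap.ker AK.norm.hom.toLinearMap := by
    refine (norm_AK _).trans ?_
    rw [← map_nsmul]
    have : 4 • x = 0 := by revert x; decide
    rw [this, map_zero]
  let F : ZMod 4 → groupCohomology AK 3 := fun x =>
    Rep.FiniteCyclicGroup.groupCohomologyπOdd AK gK gK_gen 3 (by decide) ⟨ev x, hm x⟩
  have hF : Function.Surjective F := by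
    intro y
    obtain ⟨⟨a, ha⟩, rfl⟩ := hs y
    obtain ⟨x, rfl⟩ := ev_surj a ((norm_AK a).symm.trans ha)
    exact ⟨x, rfl⟩
  refine ⟨Finite.of_surjective F hF, ?_⟩
  simpa using Nat.card_le_card_of_surjective F hF

end HThree

namespace HThree

open CategoryTheory groupCohomology

def sgn : G →* ℤ where
  toFun g := if g.toAdd.2 = 0 then 1 else -1
  map_one' := by decide
  map_mul' := by decide

noncomputable def rhoM : Representation ℤ G A :=
  ((algebraMap ℤ (Module.End ℤ A) : ℤ →+* _) : ℤ →* _).comp sgn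

lemma rhoM_apply (g : G) (a : A) : rhoM g a = sgn g • a := rfl

noncomputable abbrev AM : Rep ℤ G := Rep.of rhoM
noncomputable abbrev CI : Rep ℤ G := Rep.coind K.subtype AK

def t : G := Multiplicative.ofAdd (0, 1)

/-- elements of the coinduced module depend only on the second coordinate -/
lemma CI_mem (f : G → A) : f ∈ Representation.coindV K.subtype AK.ρ ↔
    ∀ (s : K) (g : G), f (s * g) = f g := Iff.rfl

lemma CI_val (f : G → A) (hf : f ∈ Representation.coindV K.subtype AK.ρ) (g : G) :
    f g = if g.toAdd.2 = 0 then f 1 else f t := by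
  rw [CI_mem] at hf
  split_ifs with h
  · have := hf ⟨g, h⟩ 1
    simpa using this
  · have h1 : g.toAdd.2 = 1 := by
      generalize g.toAdd.2 = z at h ⊢
      revert z; decide
    have := hf ⟨Multiplicative.ofAdd (g.toAdd.1, 0), rfl⟩ t
    rw [← this]
    congr 1
    apply Multiplicative.toAdd.injective
    exact Prod.ext (by simp [t]) (by simp [t, h1])

lemma K_snd (s : K) (g : G) : ((s : G) * g).toAdd.2 = g.toAdd.2 := by
  have : (s : G).toAdd.2 = 0 := s.2
  simp [this]

lemma sgn_K (s : K) (g : G) : sgn ((s : G) * g) = sgn g := by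
  show (if _ then _ else _) = (if _ then _ else _)
  rw [K_snd]

/-- constants -/
noncomputable def iota : AG ⟶ CI := Rep.ofHom
  { toFun a := ⟨fun _ => a, fun _ _ => rfl⟩
    map_add' _ _ := rfl
    map_smul' _ _ := rfl
    isIntertwining' _ := rfl }

/-- difference -/
noncomputable def dif : CI ⟶ AM := Rep.ofHom
  { toFun f := f.1 1 - f.1 t
    map_add' f f' := by
      show (f.1 1 + f'.1 1) - (f.1 t + f'.1 t) = _
      abel
    map_smul' n f := by
      show n • f.1 1 - n • f.1 t = n • (f.1 1 - f.1 t)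
      exact (smul_sub n (f.1 1 : A) (f.1 t : A)).symm
    isIntertwining' g := by
      refine LinearMap.ext fun f => ?_
      show f.1 (1 * g) - f.1 (t * g) = sgn g • (f.1 1 - f.1 t)
      rw [CI_val f.1 f.2 (1 * g), CI_val f.1 f.2 (t * g)]
      revert g
      have h : ∀ z : ZMod 2, z = 0 ∨ z = 1 := by decide
      intro g
      rcases h g.toAdd.2 with h | h <;> simp [sgn, t, h, CharTwo.add_self_eq_zero] }

noncomputable def tw : AM ⟶ CI := Rep.ofHom
  { toFun a := ⟨fun g => sgn g • a, fun s g => by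
      show sgn ((s : G) * g) • a = sgn g • a
      rw [sgn_K]⟩
    map_add' a b := by
      apply Subtype.ext; funext g; exact smul_add (sgn g) (a : A) (b : A)
    map_smul' n a := by
      apply Subtype.ext; funext g; exact smul_comm (sgn g) n (a : A)
    isIntertwining' g := by
      refine LinearMap.ext fun a => ?_
      apply Subtype.ext; funext x
      show sgn x • (sgn g • a) = sgn (x * g) • a
      rw [map_mul, mul_smul] }

noncomputable def sm : CI ⟶ AG := Rep.ofHom
  { toFun f := f.1 1 + f.1 t
    map_add' f f' := by
      show (f.1 1 + f'.1 1) + (f.1 t + f'.1 t) = _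
      abel
    map_smul' n f := by
      show n • f.1 1 + n • f.1 t = n • (f.1 1 + f.1 t)
      exact (smul_add n (f.1 1 : A) (f.1 t : A)).symm
    isIntertwining' g := by
      refine LinearMap.ext fun f => ?_
      show f.1 (1 * g) + f.1 (t * g) = (f.1 1 + f.1 t)
      rw [CI_val f.1 f.2 (1 * g), CI_val f.1 f.2 (t * g)]
      have h : ∀ z : ZMod 2, z = 0 ∨ z = 1 := by decide
      rcases h g.toAdd.2 with h | h <;> simp [t, h, CharTwo.add_self_eq_zero, add_comm] }

lemma sgn_one : sgn 1 = 1 := by decide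
lemma sgn_t : sgn t = -1 := by decide

lemma tw_sm (a : A) : sgn 1 • a + sgn t • a = 0 := by
  rw [sgn_one, sgn_t]; simp

lemma shortExact_mk {k G : Type} [CommRing k] [Group G] (S : ShortComplex (Rep.{0} k G))
    (h1 : Function.Injective S.f.hom) (h2 : ∀ x, S.g.hom x = 0 → ∃ y, S.f.hom y = x)
    (h3 : Function.Surjective S.g.hom) : S.ShortExact where
  exact := (forget₂ (Rep.{0} k G) (ModuleCat k)).reflects_exact_of_faithful _ <|
    (ShortComplex.moduleCat_exact_iff _).2 h2
  mono_f := (Rep.mono_iff_injective _).2 h1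
  epi_g := (Rep.epi_iff_surjective _).2 h3

noncomputable def S1 : ShortComplex (Rep ℤ G) where
  X₁ := AG
  X₂ := CI
  X₃ := AM
  f := iota
  g := dif
  zero := Rep.hom_ext (DFunLike.ext _ _ fun a => sub_self (G := A) a)

noncomputable def S2 : ShortComplex (Rep ℤ G) where
  X₁ := AM
  X₂ := CI
  X₃ := AG
  f := tw
  g := sm
  zero := Rep.hom_ext (DFunLike.ext _ _ fun a => tw_sm a)

noncomputable def bump (a : A) : CI :=
  (⟨fun g => if g.toAdd.2 = 0 then a else 0, fun s g => by
    show (if ((s : G) * g).toAdd.2 = 0 then a else 0) = if g.toAdd.2 = 0 then a else 0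
    rw [K_snd]⟩ : Representation.coindV K.subtype AK.ρ)

lemma S1_exact : S1.ShortExact := by
  refine shortExact_mk S1 ?_ ?_ ?_
  · exact fun a b h => congrFun (congrArg Subtype.val h) (1 : G)
  · intro x hx
    let f : Representation.coindV K.subtype AK.ρ := x
    have hf : f.1 1 - f.1 t = 0 := hx
    refine ⟨f.1 1, ?_⟩
    apply Subtype.ext; funext g
    show f.1 1 = f.1 g
    rw [CI_val f.1 f.2 g, ← sub_eq_zero.1 hf, ite_self]
  · exact fun a => ⟨bump a, sub_zero (G := A) a⟩

lemma S2_exact : S2.ShortExact := by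
  refine shortExact_mk S2 ?_ ?_ ?_
  · intro a b h
    have h' := congrFun (congrArg Subtype.val h) (1 : G)
    change sgn 1 • (a : A) = sgn 1 • (b : A) at h'
    rw [sgn_one] at h'
    exact (one_smul ℤ (a : A)).symm.trans (h'.trans (one_smul ℤ (b : A)))
  · intro x hx
    let f : Representation.coindV K.subtype AK.ρ := x
    have hf : f.1 1 + f.1 t = 0 := hx
    refine ⟨f.1 1, ?_⟩
    apply Subtype.ext; funext g
    show sgn g • f.1 1 = f.1 g
    rw [CI_val f.1 f.2 g, eq_neg_of_add_eq_zero_right hf]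
    show (if _ then (1 : ℤ) else -1) • (f.1 1 : A) = _
    split_ifs
    · exact one_smul ℤ (f.1 1 : A)
    · exact (neg_smul 1 (f.1 1 : A)).trans (congrArg _ (one_smul ℤ (f.1 1 : A)))
  · exact fun a => ⟨bump a, add_zero (M := A) a⟩

end HThree

namespace HThree

open CategoryTheory groupCohomology

lemma iota_sm : iota ≫ sm = 𝟙 AG + 𝟙 AG := Rep.hom_ext (DFunLike.ext _ _ fun _ => rfl)

lemma map_two {k G : Type} [CommRing k] [Group G] {A B : Rep.{0} k G} (f : A ⟶ B) (g : B ⟶ A)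
    (h : f ≫ g = 𝟙 A + 𝟙 A) (n : ℕ) (x : groupCohomology A n) :
    (groupCohomology.map (MonoidHom.id G) g n).hom
      ((groupCohomology.map (MonoidHom.id G) f n).hom x) = x + x := by
  have h1 : groupCohomology.map (MonoidHom.id G) f n ≫ groupCohomology.map (MonoidHom.id G) g n =
      𝟙 _ + 𝟙 _ := by
    rw [← groupCohomology.map_id_comp, h]
    have h2 : cochainsMap (MonoidHom.id G) (𝟙 A + 𝟙 A) =
      𝟙 (inhomogeneousCochains A) + 𝟙 (inhomogeneousCochains A) := rfl
    refine (congrArg (fun z => HomologicalComplex.homologyMap z n) h2).trans ?_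
    rw [HomologicalComplex.homologyMap_add, HomologicalComplex.homologyMap_id]
    rfl
  exact congrArg (fun z : groupCohomology A n ⟶ groupCohomology A n => z.hom x) h1

lemma delta_map {k G : Type} [CommRing k] [Group G] {S : ShortComplex (Rep.{0} k G)}
    (hS : S.ShortExact) (i j : ℕ) (hij : i + 1 = j) (x : groupCohomology S.X₂ i) :
    (groupCohomology.δ hS i j hij).hom ((groupCohomology.map (MonoidHom.id G) S.g i).hom x) = 0 := by
  have h := (mapShortComplex₃ hS hij).zero
  exact congrArg (fun z : groupCohomology S.X₂ i ⟶ groupCohomology S.X₁ j => z.hom x) h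

noncomputable def d12 : groupCohomology AG 1 →+ groupCohomology AM 2 :=
  (groupCohomology.δ S2_exact 1 2 rfl).hom.toAddMonoidHom

noncomputable def d23 : groupCohomology AM 2 →+ groupCohomology AG 3 :=
  (groupCohomology.δ S1_exact 2 3 rfl).hom.toAddMonoidHom

noncomputable def i3 : groupCohomology AG 3 →+ groupCohomology CI 3 :=
  (groupCohomology.map (MonoidHom.id G) iota 3).hom.toAddMonoidHom

lemma H2CI : Limits.IsZero (groupCohomology CI 2) := H2K.of_iso (coindIso AK 2)

lemma d12_surj : Function.Surjective d12 := by
  have := epi_δ_of_isZero S2_exact 1 H2CI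
  exact (ModuleCat.epi_iff_surjective _).1 this

lemma d12_two (x : groupCohomology AG 1) : d12 (x + x) = 0 := by
  rw [← map_two iota sm iota_sm 1 x]
  exact delta_map S2_exact 1 2 rfl _

lemma d23_exact (y : groupCohomology AG 3) (hy : i3 y = 0) : ∃ x, d23 x = y :=
  (ShortComplex.moduleCat_exact_iff _).1 (mapShortComplex₁_exact S1_exact (show 2 + 1 = 3 from rfl)) y hy

lemma H3CI : Finite (groupCohomology CI 3) ∧ Nat.card (groupCohomology CI 3) ≤ 4 := by
  have e := (coindIso AK 3).toLinearEquiv.toEquiv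
  have := H3K.1
  exact ⟨Finite.of_equiv _ e.symm, (Nat.card_congr e).trans_le H3K.2⟩

def chi1 : Additive G →+ ZMod 4 := AddMonoidHom.fst (ZMod 4) (ZMod 2)
def chi2 : Additive G →+ ZMod 4 where
  toFun g := if g.toMul.toAdd.2 = 0 then 0 else 2
  map_zero' := by decide
  map_add' := by decide

lemma char_eq (φ : Additive G →+ A) : ∃ m n : ℕ, φ = m • ev.comp chi1 + n • ev.comp chi2 := by
  let g1 : Additive G := Additive.ofMul (Multiplicative.ofAdd (1, 0))
  let g2 : Additive G := Additive.ofMul (Multiplicative.ofAdd (0, 1))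
  have h1 : 4 • φ g1 = 0 := by rw [← map_nsmul, show 4 • g1 = 0 by decide, map_zero]
  have h2 : 2 • φ g2 = 0 := by rw [← map_nsmul, show 2 • g2 = 0 by decide, map_zero]
  obtain ⟨x, hx⟩ := ev_surj _ h1
  obtain ⟨y, hy⟩ := ev_surj (φ g2) ((mul_smul 2 2 (φ g2)).trans (by rw [h2, smul_zero]))
  have hy2 : 2 * y = 0 := by
    apply ev_inj
    rw [← hy, ← map_nsmul] at h2
    simpa using h2
  obtain ⟨n, hn⟩ : ∃ n : ℕ, y = n • (2 : ZMod 4) := by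
    have : ∀ y : ZMod 4, 2 * y = 0 → y = 0 • 2 ∨ y = 1 • 2 := by decide
    rcases this y hy2 with h | h
    exacts [⟨0, h⟩, ⟨1, h⟩]
  refine ⟨x.val, n, ?_⟩
  have key : ∀ g : Additive G, g = g.toMul.toAdd.1.val • g1 + g.toMul.toAdd.2.val • g2 := by decide
  refine AddMonoidHom.ext fun g => ?_
  have e1 : φ g1 = (x.val • ev.comp chi1 + n • ev.comp chi2) g1 := by
    show _ = x.val • ev (chi1 g1) + n • ev (chi2 g1)
    rw [show chi1 g1 = 1 by decide, show chi2 g1 = 0 by decide, map_zero, smul_zero, add_zero,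
      ← map_nsmul, ← hx]
    simp
  have e2 : φ g2 = (x.val • ev.comp chi1 + n • ev.comp chi2) g2 := by
    show _ = x.val • ev (chi1 g2) + n • ev (chi2 g2)
    rw [show chi1 g2 = 0 by decide, show chi2 g2 = 2 by decide, map_zero, smul_zero, zero_add,
      ← map_nsmul, ← hn, hy]
  rw [key g, map_add, map_add, map_nsmul, map_nsmul, map_nsmul, map_nsmul, e1, e2]

noncomputable def h1e : groupCohomology AG 1 ≃+ (Additive G →+ A) :=
  (H1IsoOfIsTrivial AG).toLinearEquiv.toAddEquiv

lemma H2AM : Finite (groupCohomology AM 2) ∧ Nat.card (groupCohomology AM 2) ≤ 4 := by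
  let c1 := d12 (h1e.symm (ev.comp chi1))
  let c2 := d12 (h1e.symm (ev.comp chi2))
  have red (c : groupCohomology AM 2) (hc : c + c = 0) (m : ℕ) : m • c = (m % 2) • c := by
    conv_lhs => rw [← Nat.mod_add_div m 2]
    rw [add_smul, mul_comm, mul_smul, two_smul, hc, smul_zero, add_zero]
  have t1 : c1 + c1 = 0 := by rw [← map_add]; exact d12_two _
  have t2 : c2 + c2 = 0 := by rw [← map_add]; exact d12_two _
  let F : Fin 2 × Fin 2 → groupCohomology AM 2 := fun p => (p.1 : ℕ) • c1 + (p.2 : ℕ) • c2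
  have hF : Function.Surjective F := by
    intro y
    obtain ⟨x, rfl⟩ := d12_surj y
    obtain ⟨m, n, h⟩ := char_eq (h1e x)
    refine ⟨(⟨m % 2, Nat.mod_lt _ two_pos⟩, ⟨n % 2, Nat.mod_lt _ two_pos⟩), ?_⟩
    show (m % 2) • c1 + (n % 2) • c2 = d12 x
    rw [← red c1 t1, ← red c2 t2, ← h1e.symm_apply_apply x, h, map_add, map_add,
      show h1e.symm (m • ev.comp chi1) = m • h1e.symm (ev.comp chi1) from map_nsmul h1e.symm m _,
      show h1e.symm (n • ev.comp chi2) = n • h1e.symm (ev.comp chi2) from map_nsmul h1e.symm n _,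
      map_nsmul, map_nsmul]
  exact ⟨Finite.of_surjective F hF, by simpa using Nat.card_le_card_of_surjective F hF⟩

lemma H3AG : Finite (groupCohomology AG 3) ∧ Nat.card (groupCohomology AG 3) ≤ 16 := by
  have := H2AM.1
  have := H3CI.1
  exact card_mid d23 i3 d23_exact H2AM.2 H3CI.2

end HThree

namespace HThree

open CategoryTheory groupCohomology

abbrev P : Type := ZMod 4 × ZMod 2 × ZMod 2
abbrev V : Type := ZMod 4 × ZMod 2

def dbl : ZMod 2 →+ ZMod 4 where
  toFun z := if z = 0 then 0 else 2
  map_zero' := by decide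
  map_add' := by decide

/-- carry cocycles -/
def c4 (b c : V) : ZMod 4 := if 4 ≤ b.1.val + c.1.val then 1 else 0
def c2 (b c : V) : ZMod 4 := if 2 ≤ b.2.val + c.2.val then 1 else 0

lemma carry4 : ∀ b c d : ZMod 4, (if 4 ≤ c.val + d.val then (1 : ZMod 4) else 0)
    - (if 4 ≤ (b + c).val + d.val then (1 : ZMod 4) else 0)
    + (if 4 ≤ b.val + (c + d).val then (1 : ZMod 4) else 0)
    - (if 4 ≤ b.val + c.val then (1 : ZMod 4) else 0) = 0 := by
  decide

lemma carry2 : ∀ b c d : ZMod 2, (if 2 ≤ c.val + d.val then (1 : ZMod 4) else 0)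
    - (if 2 ≤ (b + c).val + d.val then (1 : ZMod 4) else 0)
    + (if 2 ≤ b.val + (c + d).val then (1 : ZMod 4) else 0)
    - (if 2 ≤ b.val + c.val then (1 : ZMod 4) else 0) = 0 := by
  decide

lemma c4_cocycle (b c d : V) : c4 c d - c4 (b + c) d + c4 b (c + d) - c4 b c = 0 :=
  carry4 b.1 c.1 d.1

lemma c2_cocycle (b c d : V) : c2 c d - c2 (b + c) d + c2 b (c + d) - c2 b c = 0 :=
  carry2 b.2 c.2 d.2

def coc (p : P) (a b c : V) : ZMod 4 :=
  (p.1 * a.1 + dbl (p.2.2 * a.2)) * c4 b c + dbl (p.2.1 * a.2) * c2 b c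

lemma coc_add (p q : P) (a b c : V) : coc (p + q) a b c = coc p a b c + coc q a b c := by
  simp only [coc, Prod.fst_add, Prod.snd_add, add_mul, map_add]
  ring

lemma coc_d (p : P) (a b c d : V) :
    coc p b c d - coc p (a + b) c d + coc p a (b + c) d - coc p a b (c + d) + coc p a b c = 0 := by
  simp only [coc, Prod.fst_add, Prod.snd_add, mul_add, map_add]
  linear_combination -(p.1 * a.1 + dbl (p.2.2 * a.2)) * c4_cocycle b c d
    - dbl (p.2.1 * a.2) * c2_cocycle b c d

noncomputable def F : P →+ ((Fin 3 → G) → A) where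
  toFun p g := ev (coc p (g 0).toAdd (g 1).toAdd (g 2).toAdd)
  map_zero' := by
    funext g
    show ev _ = 0
    simp [coc]
  map_add' p q := by
    funext g
    show ev _ = ev _ + ev _
    rw [coc_add, map_add]

lemma d3_apply (f : (Fin 3 → G) → A) (g : Fin 4 → G) :
    (inhomogeneousCochains.d AG 3).hom f g =
      f ![g 1, g 2, g 3] - f ![g 0 * g 1, g 2, g 3] + f ![g 0, g 1 * g 2, g 3]
        - f ![g 0, g 1, g 2 * g 3] + f ![g 0, g 1, g 2] := by
  have e (j : Fin 4) (v : Fin 3 → G) (h : ∀ k, Fin.contractNth j (· * ·) g k = v k) :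
    f (Fin.contractNth j (· * ·) g) = f v := congrArg f (funext h)
  have hs : (fun i : Fin 3 => g i.succ) = ![g 1, g 2, g 3] := by
    funext k; fin_cases k <;> rfl
  refine (inhomogeneousCochains.d_hom_apply AG 3 f g).trans ?_
  refine (congrArg₂ (· + ·) (congrArg f hs) (Fin.sum_univ_four _)).trans ?_
  rw [e 0 ![g 0 * g 1, g 2, g 3] (by intro k; fin_cases k <;> rfl),
    e 1 ![g 0, g 1 * g 2, g 3] (by intro k; fin_cases k <;> rfl),
    e 2 ![g 0, g 1, g 2 * g 3] (by intro k; fin_cases k <;> rfl),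
    e 3 ![g 0, g 1, g 2] (by intro k; fin_cases k <;> rfl)]
  generalize f ![g 1, g 2, g 3] = x0
  generalize f ![g 0 * g 1, g 2, g 3] = x1
  generalize f ![g 0, g 1 * g 2, g 3] = x2
  generalize f ![g 0, g 1, g 2 * g 3] = x3
  generalize f ![g 0, g 1, g 2] = x4
  show x0 + ((-1 : ℤ) ^ 1 • x1 + (-1 : ℤ) ^ 2 • x2 + (-1 : ℤ) ^ 3 • x3 + (-1 : ℤ) ^ 4 • x4) = _
  norm_num
  abel

lemma d2_apply (f : (Fin 2 → G) → A) (g : Fin 3 → G) :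
    (inhomogeneousCochains.d AG 2).hom f g =
      f ![g 1, g 2] - f ![g 0 * g 1, g 2] + f ![g 0, g 1 * g 2] - f ![g 0, g 1] := by
  have e (j : Fin 3) (v : Fin 2 → G) (h : ∀ k, Fin.contractNth j (· * ·) g k = v k) :
    f (Fin.contractNth j (· * ·) g) = f v := congrArg f (funext h)
  have hs : (fun i : Fin 2 => g i.succ) = ![g 1, g 2] := by
    funext k; fin_cases k <;> rfl
  refine (inhomogeneousCochains.d_hom_apply AG 2 f g).trans ?_
  refine (congrArg₂ (· + ·) (congrArg f hs) (Fin.sum_univ_three _)).trans ?_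
  rw [e 0 ![g 0 * g 1, g 2] (by intro k; fin_cases k <;> rfl),
    e 1 ![g 0, g 1 * g 2] (by intro k; fin_cases k <;> rfl),
    e 2 ![g 0, g 1] (by intro k; fin_cases k <;> rfl)]
  generalize f ![g 1, g 2] = x0
  generalize f ![g 0 * g 1, g 2] = x1
  generalize f ![g 0, g 1 * g 2] = x2
  generalize f ![g 0, g 1] = x3
  show x0 + ((-1 : ℤ) ^ 1 • x1 + (-1 : ℤ) ^ 2 • x2 + (-1 : ℤ) ^ 3 • x3) = _
  norm_num
  abel

lemma F_cocycle (p : P) : (inhomogeneousCochains.d AG 3).hom (F p) = 0 := by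
  funext g
  refine (d3_apply (F p) g).trans ?_
  show ev (coc p (g 1).toAdd (g 2).toAdd (g 3).toAdd)
    - ev (coc p ((g 0).toAdd + (g 1).toAdd) (g 2).toAdd (g 3).toAdd)
    + ev (coc p (g 0).toAdd ((g 1).toAdd + (g 2).toAdd) (g 3).toAdd)
    - ev (coc p (g 0).toAdd (g 1).toAdd ((g 2).toAdd + (g 3).toAdd))
    + ev (coc p (g 0).toAdd (g 1).toAdd (g 2).toAdd) = 0
  rw [← map_sub, ← map_add, ← map_sub, ← map_add, coc_d, map_zero]

lemma iCocycles_inj {k G : Type} [CommRing k] [Group G] (A : Rep.{0} k G) (n : ℕ) :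
    Function.Injective (iCocycles A n).hom :=
  (ModuleCat.mono_iff_injective _).1 inferInstance

noncomputable def Fc : P →+ cocycles AG 3 :=
  AddMonoidHom.mk' (fun p => cocyclesMk (A := AG) (F p) (F_cocycle p)) (by
    intro p q
    apply iCocycles_inj
    refine Eq.trans ?_ (map_add (iCocycles AG 3).hom _ _).symm
    refine (iCocycles_mk (A := AG) _ _).trans ?_
    refine Eq.trans ?_ (congrArg₂ (· + ·) (iCocycles_mk (A := AG) (F p) (F_cocycle p)).symm
      (iCocycles_mk (A := AG) (F q) (F_cocycle q)).symm)
    exact map_add F p q)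

noncomputable def Phi : P →+ groupCohomology AG 3 :=
  (groupCohomology.π AG 3).hom.toAddMonoidHom.comp Fc

lemma exists_cobound {k : Type} [CommRing k] (C : CochainComplex (ModuleCat.{0} k) ℕ) (i j : ℕ)
    (hij : i + 1 = j) (x : C.cycles j) (hx : (C.homologyπ j).hom x = 0) :
    ∃ y : C.X i, (C.d i j).hom y = (C.iCycles j).hom x := by
  have hp : (ComplexShape.up ℕ).prev j = i := (ComplexShape.up ℕ).prev_eq' hij
  have ex : (ShortComplex.mk (C.toCycles i j) (C.homologyπ j) (by simp)).Exact :=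
    ShortComplex.exact_of_g_is_cokernel _ (C.homologyIsCokernel i j hp)
  obtain ⟨y, hy⟩ := (ShortComplex.moduleCat_exact_iff _).1 ex x hx
  refine ⟨y, ?_⟩
  have h := C.toCycles_i i j
  rw [← h, ModuleCat.hom_comp]
  exact congrArg (C.iCycles j).hom hy

lemma Phi_ker (p : P) (hp : Phi p = 0) :
    ∃ f : (Fin 2 → G) → A, (inhomogeneousCochains.d AG 2).hom f = F p := by
  obtain ⟨y, hy⟩ := exists_cobound (inhomogeneousCochains AG) 2 3 rfl (Fc p) hp
  rw [inhomogeneousCochains.d_def] at hy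
  exact ⟨y, hy.trans (iCocycles_mk (A := AG) (F p) (F_cocycle p))⟩

lemma cyc_sum (p : P) (hp : Phi p = 0) (g : V) (n : ℕ) (hn : n • g = 0) :
    ∑ j ∈ Finset.range n, coc p g (j • g) g = 0 := by
  obtain ⟨f, hf⟩ := Phi_ker p hp
  apply ev_inj
  rw [map_sum]
  let m : V → G := Multiplicative.ofAdd
  let φ : ℕ → A := fun j => f ![m g, m (j • g)] - f ![m (j • g), m g]
  have h (j : ℕ) : ev (coc p g (j • g) g) = φ (j + 1) - φ j := by
    have h1 : ev (coc p g (j • g) g) = F p ![m g, m (j • g), m g] := rfl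
    rw [h1, ← hf]
    refine (d2_apply f _).trans ?_
    show f ![m (j • g), m g] - f ![m (g + j • g), m g] + f ![m g, m (j • g + g)] - f ![m g, m (j • g)] = _
    simp only [φ, succ_nsmul, add_comm g]
    abel
  rw [Finset.sum_congr rfl fun j _ => h j, Finset.sum_range_sub]
  show (f ![m g, m (n • g)] - f ![m (n • g), m g])
    - (f ![m g, m (0 • g)] - f ![m (0 • g), m g]) = ev 0
  rw [hn, zero_nsmul, map_zero]
  exact sub_self _

lemma Phi_inj : Function.Injective Phi := by
  rw [injective_iff_map_eq_zero]
  intro p hp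
  have h1 := cyc_sum p hp (1, 0) 4 (by decide)
  have h2 := cyc_sum p hp (0, 1) 2 (by decide)
  have h3 := cyc_sum p hp (1, 1) 4 (by decide)
  revert h1 h2 h3
  clear hp
  revert p
  decide

end HThree

/-- The group cohomology `H³(ℤ/4ℤ × ℤ/2ℤ, ℂˣ)` with coefficients in the
trivial module `ℂˣ` is isomorphic, as an abelian group, to
`ℤ/4ℤ × ℤ/2ℤ × ℤ/2ℤ`. -/
theorem groupCohomology_three_Z4xZ2 :
    Nonempty
      ((groupCohomology
        (Rep.trivial ℤ (Multiplicative (ZMod 4 × ZMod 2)) (Additive ℂˣ)) 3) ≃+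
        (ZMod 4 × ZMod 2 × ZMod 2)) := by
  have := HThree.H3AG.1
  have hc : Nat.card HThree.P = 16 := by simp
  have hb : Function.Bijective HThree.Phi :=
    (Nat.bijective_iff_injective_and_card HThree.Phi).2
      ⟨HThree.Phi_inj, le_antisymm (Nat.card_le_card_of_injective _ HThree.Phi_inj) (hc ▸ HThree.H3AG.2)⟩
  exact ⟨(AddEquiv.ofBijective HThree.Phi hb).symm⟩
end

section
/- The group cohomology H^3(D_8, ℂ^×) of the dihedral group D_8 of order 8 with coefficients in the trivial module ℂ^× is isomorphic as an abelian group to ℤ/4ℤ × ℤ/2ℤ × ℤ/2ℤ. -/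
open CategoryTheory

namespace D8

section General

variable {k G : Type} [CommRing k] [Group G]

/-- The kernel of a map of representations, as a concrete representation. -/
noncomputable def kerRho {I J : Rep.{0} k G} (d : I ⟶ J) :
    Representation k G (LinearMap.ker d.hom.toLinearMap) where
  toFun g := (I.ρ g).restrict (fun x hx => by
    have := Rep.hom_comm_apply d g x
    simp only [LinearMap.mem_ker, Representation.IntertwiningMap.toLinearMap_apply] at hx ⊢
    rw [this, hx, map_zero])
  map_one' := by ext; simp
  map_mul' x y := by ext; simp

noncomputable abbrev kerRep {I J : Rep.{0} k G} (d : I ⟶ J) : Rep.{0} k G := Rep.of (kerRho d)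

noncomputable def kerIncl {I J : Rep.{0} k G} (d : I ⟶ J) : kerRep d ⟶ I :=
  Rep.ofHom ⟨(LinearMap.ker d.hom.toLinearMap).subtype, fun g => by ext; rfl⟩

noncomputable def kerLift {X I J : Rep.{0} k G} (f : X ⟶ I) (d : I ⟶ J)
    (h : ∀ x, d.hom (f.hom x) = 0) : X ⟶ kerRep d :=
  Rep.ofHom ⟨LinearMap.codRestrict _ f.hom.toLinearMap h, fun g => by
    ext x; exact Rep.hom_comm_apply f g x⟩

lemma kerLift_coe {X I J : Rep.{0} k G} (f : X ⟶ I) (d : I ⟶ J)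
    (h : ∀ x, d.hom (f.hom x) = 0) (x : X) : ((kerLift f d h).hom x).1 = f.hom x := rfl

lemma kerIncl_apply {I J : Rep.{0} k G} (d : I ⟶ J) (x : kerRep d) :
    (kerIncl d).hom x = x.1 := rfl

lemma shortExact_of {X : ShortComplex (Rep.{0} k G)} (h1 : Function.Injective X.f.hom)
    (h2 : ∀ x, X.g.hom x = 0 → ∃ y, X.f.hom y = x) (h3 : Function.Surjective X.g.hom) :
    X.ShortExact := by
  have : Mono X.f := (Rep.mono_iff_injective _).2 h1
  have : Epi X.g := (Rep.epi_iff_surjective _).2 h3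
  refine ⟨?_⟩
  apply (forget₂ (Rep.{0} k G) (ModuleCat k)).reflects_exact_of_faithful
  rw [ShortComplex.moduleCat_exact_iff]
  exact h2

/-- The short complex `X ⟶ I ⟶ ker h` -/
noncomputable abbrev sc {X I J K : Rep.{0} k G} (f : X ⟶ I) (g : I ⟶ J) (h : J ⟶ K)
    (hfg : ∀ x, g.hom (f.hom x) = 0) (hgh : ∀ x, h.hom (g.hom x) = 0) :
    ShortComplex (Rep.{0} k G) :=
  ShortComplex.mk f (kerLift g h hgh) (by
    apply Rep.hom_ext; ext x; exact hfg x)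

lemma sc_exact {X I J K : Rep.{0} k G} (f : X ⟶ I) (g : I ⟶ J) (h : J ⟶ K)
    (hfg : ∀ x, g.hom (f.hom x) = 0) (hgh : ∀ x, h.hom (g.hom x) = 0)
    (hf : Function.Injective f.hom) (eI : ∀ x, g.hom x = 0 → ∃ y, f.hom y = x)
    (eJ : ∀ x, h.hom x = 0 → ∃ y, g.hom y = x) : (sc f g h hfg hgh).ShortExact := by
  apply shortExact_of
  · exact hf
  · intro x hx
    exact eI x (congrArg Subtype.val hx)
  · rintro ⟨x, hx⟩
    obtain ⟨y, hy⟩ := eJ x hx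
    exact ⟨y, Subtype.ext hy⟩

/-- Cohomological triviality in positive degrees. -/
def Acyclic (I : Rep.{0} k G) : Prop := ∀ n : ℕ, Limits.IsZero (groupCohomology I (n + 1))

/-- Dimension shifting. -/
theorem shift {A I0 I1 I2 I3 I4 : Rep.{0} k G} (e : A ⟶ I0) (d0 : I0 ⟶ I1) (d1 : I1 ⟶ I2)
    (d2 : I2 ⟶ I3) (d3 : I3 ⟶ I4)
    (h0 : ∀ x, d0.hom (e.hom x) = 0) (h1 : ∀ x, d1.hom (d0.hom x) = 0)
    (h2 : ∀ x, d2.hom (d1.hom x) = 0) (h3 : ∀ x, d3.hom (d2.hom x) = 0)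
    (he : Function.Injective e.hom)
    (e0 : ∀ x, d0.hom x = 0 → ∃ y, e.hom y = x)
    (e1 : ∀ x, d1.hom x = 0 → ∃ y, d0.hom y = x)
    (e2 : ∀ x, d2.hom x = 0 → ∃ y, d1.hom y = x)
    (e3 : ∀ x, d3.hom x = 0 → ∃ y, d2.hom y = x)
    (a0 : Acyclic I0) (a1 : Acyclic I1) (a2 : Acyclic I2) :
    ∃ φ : (kerRep d3).ρ.invariants →+ groupCohomology A 3, Function.Surjective φ ∧
      ∀ z, φ z = 0 ↔ ∃ w : I2.ρ.invariants, d2.hom w.1 = z.1.1 := by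
  have s0 := sc_exact e d0 d1 h0 h1 he e0 e1
  have s1 := sc_exact (kerIncl d1) d1 d2 (fun x => x.2) h2 Subtype.val_injective
    (fun x hx => ⟨⟨x, hx⟩, rfl⟩) e2
  have s2 := sc_exact (kerIncl d2) d2 d3 (fun x => x.2) h3 Subtype.val_injective
    (fun x hx => ⟨⟨x, hx⟩, rfl⟩) e3
  have i0 : IsIso (groupCohomology.δ s0 2 3 rfl) :=
    groupCohomology.isIso_δ_of_isZero s0 2 (a0 1) (a0 2)
  have i1 : IsIso (groupCohomology.δ s1 1 2 rfl) :=
    groupCohomology.isIso_δ_of_isZero s1 1 (a1 0) (a1 1)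
  have i2 : Epi (groupCohomology.δ s2 0 1 rfl) :=
    groupCohomology.epi_δ_of_isZero s2 0 (a2 0)
  let ψ : groupCohomology (kerRep d2) 1 ⟶ groupCohomology A 3 :=
    groupCohomology.δ s1 1 2 rfl ≫ groupCohomology.δ s0 2 3 rfl
  have iψ : IsIso ψ := inferInstance
  let θ := (groupCohomology.H0Iso (kerRep d3)).inv ≫ groupCohomology.δ s2 0 1 rfl
  have iθ : Epi θ := inferInstance
  refine ⟨(θ ≫ ψ).hom.toAddMonoidHom, ?_, ?_⟩
  · have : Epi (θ ≫ ψ) := inferInstance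
    exact (ModuleCat.epi_iff_surjective _).1 this
  · intro z
    have hψ : Function.Injective ψ.hom :=
      (ModuleCat.mono_iff_injective ψ).1 inferInstance
    have key := (ShortComplex.moduleCat_exact_iff _).1
      (groupCohomology.mapShortComplex₃_exact s2 (i := 0) (j := 1) rfl)
    have comm := groupCohomology.map_id_comp_H0Iso_hom (kerLift d2 d3 h3)
    constructor
    · intro hz
      have hzz : θ.hom z = 0 := hψ (by rw [map_zero]; exact hz)
      obtain ⟨y, hy⟩ := key ((groupCohomology.H0Iso (kerRep d3)).inv z) hzz
      refine ⟨(groupCohomology.H0Iso I2).hom y, ?_⟩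
      have c := ConcreteCategory.congr_hom comm y
      have c2 := congrArg (groupCohomology.H0Iso (kerRep d3)).hom hy
      have c3 : (groupCohomology.H0Iso (kerRep d3)).hom
          ((groupCohomology.H0Iso (kerRep d3)).inv z) = z := by simp
      have c4 := (c.symm.trans c2).trans c3
      exact congrArg (fun t => t.1.1) c4
    · rintro ⟨w, hw⟩
      have c := ConcreteCategory.congr_hom comm ((groupCohomology.H0Iso I2).inv w)
      have c1 : (groupCohomology.H0Iso I2).hom ((groupCohomology.H0Iso I2).inv w) = w := by simp
      have c2 : (groupCohomology.H0Iso (kerRep d3)).hom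
          (groupCohomology.map (MonoidHom.id G) (kerLift d2 d3 h3) 0
            ((groupCohomology.H0Iso I2).inv w)) = z := by
        refine c.trans ?_
        refine (congrArg ((Rep.invariantsFunctor k G).map (kerLift d2 d3 h3)) c1).trans ?_
        exact Subtype.ext (Subtype.ext hw)
      have c3 := congrArg (groupCohomology.H0Iso (kerRep d3)).inv c2
      have c4 : groupCohomology.map (MonoidHom.id G) (kerLift d2 d3 h3) 0
            ((groupCohomology.H0Iso I2).inv w) = (groupCohomology.H0Iso (kerRep d3)).inv z := by
        rw [← c3]; simp
      have c5 : θ.hom z = 0 := by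
        have := ConcreteCategory.congr_hom (groupCohomology.mapShortComplex₃ s2 (i := 0) (j := 1) rfl).zero
          ((groupCohomology.H0Iso I2).inv w)
        refine Eq.trans ?_ this
        exact congrArg (groupCohomology.δ s2 0 1 rfl) c4.symm
      change ψ.hom (θ.hom z) = 0
      rw [c5, map_zero]

end General

section Fun

variable {k G : Type} [CommRing k] [Group G] (M : Type) [AddCommGroup M] [Module k M]

/-- Right translation on `n`-tuples of functions. -/
def funRho (k G : Type) [CommRing k] [Group G] (M : Type) [AddCommGroup M] [Module k M] (n : ℕ) :
    Representation k G (Fin n → G → M) where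
  toFun g :=
    { toFun := fun v i h => v i (h * g)
      map_add' := fun _ _ => rfl
      map_smul' := fun _ _ => rfl }
  map_one' := by ext; simp
  map_mul' x y := by ext; simp [mul_assoc]

noncomputable abbrev funRep (k G : Type) [CommRing k] [Group G] (M : Type) [AddCommGroup M]
    [Module k M] (n : ℕ) : Rep.{0} k G := Rep.of (funRho k G M n)

noncomputable def funIso (n : ℕ) : funRep k G M n ≅
    Rep.coind (⊥ : Subgroup G).subtype (Rep.trivial k (⊥ : Subgroup G) (Fin n → M)) :=
  Rep.mkIso (.mk
    { toFun := fun v => ⟨fun h i => v i h, by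
        rintro ⟨g, hg⟩ h
        obtain rfl := Subgroup.mem_bot.1 hg
        simp⟩
      map_add' := fun _ _ => rfl
      map_smul' := fun _ _ => rfl
      invFun := fun f i h => f.1 h i
      left_inv := fun _ => rfl
      right_inv := fun _ => rfl } fun g => by ext; rfl)

lemma acyclic_fun (n : ℕ) : Acyclic (funRep k G M n) := fun m =>
  ((isZero_groupCohomology_succ_of_subsingleton
    (Rep.trivial k (⊥ : Subgroup G) (Fin n → M)) m).of_iso
      (groupCohomology.coindIso _ (m + 1))).of_iso
        ((groupCohomology.functor k G (m + 1)).mapIso (funIso M n))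

end Fun

section Dihedral

open DihedralGroup

variable {k : Type} [CommRing k] {M : Type} [AddCommGroup M] [Module k M]

abbrev D := DihedralGroup 4

/-- left translations -/
def T : (D → M) →+ (D → M) where
  toFun f h := f (r 1 * h)
  map_zero' := rfl
  map_add' _ _ := rfl

def S : (D → M) →+ (D → M) where
  toFun f h := f (sr 0 * h)
  map_zero' := rfl
  map_add' _ _ := rfl

def Sr : (D → M) →+ (D → M) where
  toFun f h := f (sr 1 * h)
  map_zero' := rfl
  map_add' _ _ := rfl

def N : (D → M) →+ (D → M) where
  toFun f h := f h + f (r 1 * h) + f (r 2 * h) + f (r 3 * h)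
  map_zero' := by ext; simp
  map_add' f g := by ext; simp; abel

lemma TS (f : D → M) : T (S f) = Sr f := by
  ext h
  change f (sr 0 * (r 1 * h)) = f (sr 1 * h)
  rw [← mul_assoc]; rfl

lemma SrT (f : D → M) : Sr (T f) = S f := by
  ext h
  change f (r 1 * (sr 1 * h)) = f (sr 0 * h)
  rw [← mul_assoc]; rfl

lemma SS (f : D → M) : S (S f) = f := by
  ext h
  change f (sr 0 * (sr 0 * h)) = f h
  rw [← mul_assoc, show (sr 0 * sr 0 : D) = 1 from rfl, one_mul]

lemma SrSr (f : D → M) : Sr (Sr f) = f := by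
  ext h
  change f (sr 1 * (sr 1 * h)) = f h
  rw [← mul_assoc, show (sr 1 * sr 1 : D) = 1 from rfl, one_mul]

lemma NSr (f : D → M) : N (Sr f) = S (N f) := by
  ext h
  change f (sr 1 * h) + f (sr 1 * (r 1 * h)) + f (sr 1 * (r 2 * h)) + f (sr 1 * (r 3 * h))
    = f (sr 0 * h) + f (r 1 * (sr 0 * h)) + f (r 2 * (sr 0 * h)) + f (r 3 * (sr 0 * h))
  simp only [← mul_assoc]
  change f (sr 1 * h) + f (sr 2 * h) + f (sr 3 * h) + f (sr 0 * h)
    = f (sr 0 * h) + f (sr 3 * h) + f (sr 2 * h) + f (sr 1 * h)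
  abel

lemma TN (f : D → M) : T (N f) = N f := by
  ext h
  change f (r 1 * h) + f (r 1 * (r 1 * h)) + f (r 2 * (r 1 * h)) + f (r 3 * (r 1 * h))
    = f h + f (r 1 * h) + f (r 2 * h) + f (r 3 * h)
  simp only [← mul_assoc, show (r 1 * r 1 : D) = r 2 from rfl, show (r 2 * r 1 : D) = r 3 from rfl,
    show (r 3 * r 1 : D) = 1 from rfl, one_mul]
  abel

lemma NT (f : D → M) : N (T f) = N f := by
  ext h
  change f (r 1 * h) + f (r 1 * (r 1 * h)) + f (r 1 * (r 2 * h)) + f (r 1 * (r 3 * h))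
    = f h + f (r 1 * h) + f (r 2 * h) + f (r 3 * h)
  simp only [← mul_assoc, show (r 1 * r 1 : D) = r 2 from rfl, show (r 1 * r 2 : D) = r 3 from rfl,
    show (r 1 * r 3 : D) = 1 from rfl, one_mul]
  abel

lemma forall_D {P : D → Prop} : (∀ h, P h) ↔ (P (r 0) ∧ P (r 1) ∧ P (r 2) ∧ P (r 3) ∧
    P (sr 0) ∧ P (sr 1) ∧ P (sr 2) ∧ P (sr 3)) := by
  constructor
  · intro h; simp [h]
  · rintro ⟨h0, h1, h2, h3, h4, h5, h6, h7⟩ (i | i)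
    · match i with
      | 0 => exact h0
      | 1 => exact h1
      | 2 => exact h2
      | 3 => exact h3
    · match i with
      | 0 => exact h4
      | 1 => exact h5
      | 2 => exact h6
      | 3 => exact h7

/-- a function from its eight values -/
def mk (a0 a1 a2 a3 b0 b1 b2 b3 : M) : D → M
  | r i => (![a0, a1, a2, a3] : Fin 4 → M) i
  | sr i => (![b0, b1, b2, b3] : Fin 4 → M) i

lemma T_iff (f g : D → M) : T f = g ↔
    (f (r 1) = g (r 0) ∧ f (r 2) = g (r 1) ∧ f (r 3) = g (r 2) ∧ f (r 0) = g (r 3) ∧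
    f (sr 3) = g (sr 0) ∧ f (sr 0) = g (sr 1) ∧ f (sr 1) = g (sr 2) ∧ f (sr 2) = g (sr 3)) := by
  rw [funext_iff, forall_D]; rfl

lemma S_iff (f g : D → M) : S f = g ↔
    (f (sr 0) = g (r 0) ∧ f (sr 1) = g (r 1) ∧ f (sr 2) = g (r 2) ∧ f (sr 3) = g (r 3) ∧
    f (r 0) = g (sr 0) ∧ f (r 1) = g (sr 1) ∧ f (r 2) = g (sr 2) ∧ f (r 3) = g (sr 3)) := by
  rw [funext_iff, forall_D]; rfl

lemma N_iff (f g : D → M) : N f = g ↔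
    (f (r 0) + f (r 1) + f (r 2) + f (r 3) = g (r 0) ∧
     f (r 1) + f (r 2) + f (r 3) + f (r 0) = g (r 1) ∧
     f (r 2) + f (r 3) + f (r 0) + f (r 1) = g (r 2) ∧
     f (r 3) + f (r 0) + f (r 1) + f (r 2) = g (r 3) ∧
     f (sr 0) + f (sr 3) + f (sr 2) + f (sr 1) = g (sr 0) ∧
     f (sr 1) + f (sr 0) + f (sr 3) + f (sr 2) = g (sr 1) ∧
     f (sr 2) + f (sr 1) + f (sr 0) + f (sr 3) = g (sr 2) ∧
     f (sr 3) + f (sr 2) + f (sr 1) + f (sr 0) = g (sr 3)) := by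
  rw [funext_iff, forall_D]; rfl

lemma exN (f : D → M) (h : T f - f = 0) : ∃ g, N g = f := by
  rw [sub_eq_zero, T_iff] at h
  obtain ⟨h1, h2, h3, -, h4, h5, h6, -⟩ := h
  refine ⟨mk (f (r 0)) 0 0 0 (f (sr 0)) 0 0 0, ?_⟩
  rw [N_iff]
  change f (r 0) + 0 + 0 + 0 = _ ∧ 0 + 0 + 0 + f (r 0) = _ ∧ 0 + 0 + f (r 0) + 0 = _ ∧
    0 + f (r 0) + 0 + 0 = _ ∧ f (sr 0) + 0 + 0 + 0 = _ ∧ 0 + f (sr 0) + 0 + 0 = _ ∧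
    0 + 0 + f (sr 0) + 0 = _ ∧ 0 + 0 + 0 + f (sr 0) = _
  simp [h1, h2, h3, h4, h5, h6]

lemma exT (f : D → M) (h : N f = 0) : ∃ g, T g - g = f := by
  rw [N_iff] at h
  obtain ⟨h1, -, -, -, h2, -⟩ := h
  refine ⟨mk 0 (f (r 0)) (f (r 0) + f (r 1)) (f (r 0) + f (r 1) + f (r 2))
    0 (f (sr 0) + f (sr 3) + f (sr 2)) (f (sr 0) + f (sr 3)) (f (sr 0)), ?_⟩
  rw [sub_eq_iff_eq_add, T_iff]
  change f (r 0) = f (r 0) + 0 ∧ f (r 0) + f (r 1) = f (r 1) + f (r 0) ∧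
    f (r 0) + f (r 1) + f (r 2) = f (r 2) + (f (r 0) + f (r 1)) ∧
    0 = f (r 3) + (f (r 0) + f (r 1) + f (r 2)) ∧
    f (sr 0) = f (sr 0) + 0 ∧ 0 = f (sr 1) + (f (sr 0) + f (sr 3) + f (sr 2)) ∧
    f (sr 0) + f (sr 3) + f (sr 2) = f (sr 2) + (f (sr 0) + f (sr 3)) ∧
    f (sr 0) + f (sr 3) = f (sr 3) + f (sr 0)
  change _ = (0 : M) at h1
  change _ = (0 : M) at h2
  refine ⟨by abel, by abel, by abel, ?_, by abel, ?_, by abel, by abel⟩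
  · rw [← h1]; abel
  · rw [← h2]; abel

lemma exSm (f : D → M) (h : T f - f = 0) (hh : S f + f = 0) : ∃ g, T g - g = 0 ∧ S g - g = f := by
  rw [sub_eq_zero, T_iff] at h
  obtain ⟨h1, h2, h3, -, h4, h5, h6, -⟩ := h
  rw [add_eq_zero_iff_eq_neg, S_iff] at hh
  have h7 : f (sr 0) = - f (r 0) := hh.1
  refine ⟨mk (-f (r 0)) (-f (r 0)) (-f (r 0)) (-f (r 0)) 0 0 0 0, ?_, ?_⟩
  · rw [sub_eq_zero, T_iff]
    exact ⟨rfl, rfl, rfl, rfl, rfl, rfl, rfl, rfl⟩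
  · rw [sub_eq_iff_eq_add, S_iff]
    change 0 = f (r 0) + -f (r 0) ∧ 0 = f (r 1) + -f (r 0) ∧ 0 = f (r 2) + -f (r 0) ∧
      0 = f (r 3) + -f (r 0) ∧ -f (r 0) = f (sr 0) + 0 ∧ -f (r 0) = f (sr 1) + 0 ∧
      -f (r 0) = f (sr 2) + 0 ∧ -f (r 0) = f (sr 3) + 0
    simp [h1, h2, h3, h4, h7, ← h5, ← h6]

lemma exSp (f : D → M) (h : T f - f = 0) (hh : S f - f = 0) : ∃ g, T g - g = 0 ∧ S g + g = f := by
  rw [sub_eq_zero, T_iff] at h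
  obtain ⟨h1, h2, h3, -, h4, h5, h6, -⟩ := h
  rw [sub_eq_zero, S_iff] at hh
  have h7 : f (sr 0) = f (r 0) := hh.1
  refine ⟨mk (f (r 0)) (f (r 0)) (f (r 0)) (f (r 0)) 0 0 0 0, ?_, ?_⟩
  · rw [sub_eq_zero, T_iff]
    exact ⟨rfl, rfl, rfl, rfl, rfl, rfl, rfl, rfl⟩
  · rw [← eq_sub_iff_add_eq, S_iff]
    change 0 = f (r 0) - f (r 0) ∧ 0 = f (r 1) - f (r 0) ∧ 0 = f (r 2) - f (r 0) ∧
      0 = f (r 3) - f (r 0) ∧ f (r 0) = f (sr 0) - 0 ∧ f (r 0) = f (sr 1) - 0 ∧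
      f (r 0) = f (sr 2) - 0 ∧ f (r 0) = f (sr 3) - 0
    simp [h1, h2, h3, h4, h7, ← h5, ← h6]

lemma ex0 (f : D → M) (h : T f - f = 0) (hh : S f - f = 0) (h : D) : f h = f 1 := by
  rename_i h0
  rw [sub_eq_zero, T_iff] at h0
  obtain ⟨h1, h2, h3, -, h4, h5, h6, -⟩ := h0
  rw [sub_eq_zero, S_iff] at hh
  have h7 : f (sr 0) = f (r 0) := hh.1
  change f h = f (r 0)
  revert h
  rw [forall_D]
  simp [h1, h2, h3, h4, h7, ← h5, ← h6]

/-- right translation -/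
def R (g : D) (f : D → M) : D → M := fun h => f (h * g)

lemma R_add (g : D) (a b : D → M) : R g (a + b) = R g a + R g b := rfl
lemma R_sub (g : D) (a b : D → M) : R g (a - b) = R g a - R g b := rfl
lemma R_neg (g : D) (a : D → M) : R g (-a) = - R g a := rfl
lemma T_R (g : D) (f : D → M) : T (R g f) = R g (T f) := by
  ext h; exact congrArg f (mul_assoc _ _ _)
lemma S_R (g : D) (f : D → M) : S (R g f) = R g (S f) := by
  ext h; exact congrArg f (mul_assoc _ _ _)
lemma Sr_R (g : D) (f : D → M) : Sr (R g f) = R g (Sr f) := by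
  ext h; exact congrArg f (mul_assoc _ _ _)
lemma N_R (g : D) (f : D → M) : N (R g f) = R g (N f) := by
  ext h
  change f (h * g) + f ((r 1 * h) * g) + f ((r 2 * h) * g) + f ((r 3 * h) * g) =
    f (h * g) + f (r 1 * (h * g)) + f (r 2 * (h * g)) + f (r 3 * (h * g))
  simp only [mul_assoc]

set_option linter.unusedSectionVars false
lemma T_smul (c : k) (f : D → M) : T (c • f) = c • T f := rfl
lemma S_smul (c : k) (f : D → M) : S (c • f) = c • S f := rfl
lemma Sr_smul (c : k) (f : D → M) : Sr (c • f) = c • Sr f := rfl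
lemma N_smul (c : k) (f : D → M) : N (c • f) = c • N f := by
  ext h
  change c • f h + c • f (r 1 * h) + c • f (r 2 * h) + c • f (r 3 * h) =
    c • (f h + f (r 1 * h) + f (r 2 * h) + f (r 3 * h))
  simp only [smul_add]

lemma funRho_apply (n : ℕ) (g : D) (v : Fin n → D → M) (i : Fin n) :
    funRho k D M n g v i = R g (v i) := rfl

/-- Build a morphism of representations. -/
noncomputable def mkHom (m n : ℕ) (F : (Fin m → D → M) → (Fin n → D → M))
    (h1 : ∀ (v w : Fin m → D → M) i, F (fun j => v j + w j) i = F v i + F w i)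
    (h2 : ∀ (c : k) (v : Fin m → D → M) i, F (fun j => c • v j) i = c • F v i)
    (h3 : ∀ (g : D) (v : Fin m → D → M) i, F (fun j => R g (v j)) i = R g (F v i)) :
    funRep k D M m ⟶ funRep k D M n :=
  Rep.ofHom ⟨{ toFun := F
               map_add' := fun v w => funext (h1 v w)
               map_smul' := fun c v => funext (h2 c v) },
    fun g => LinearMap.ext fun v => funext (h3 g v)⟩

def F0 (v : Fin 1 → D → M) : Fin 2 → D → M := ![S (v 0) - v 0, T (v 0) - v 0]
def F1 (v : Fin 2 → D → M) : Fin 3 → D → M :=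
  ![S (v 0) + v 0, -(T (v 0) - v 0) + (-Sr (v 1) - v 1), N (v 1)]
def F2 (v : Fin 3 → D → M) : Fin 4 → D → M :=
  ![S (v 0) - v 0, (T (v 0) - v 0) + (-Sr (v 1) + v 1), -N (v 1) + (-S (v 2) - v 2),
    T (v 2) - v 2]
def F3 (v : Fin 4 → D → M) : Fin 5 → D → M :=
  ![S (v 0) + v 0, -(T (v 0) - v 0) + (-Sr (v 1) - v 1), N (v 1) + (-S (v 2) + v 2),
    -(T (v 2) - v 2) + (Sr (v 3) - v 3), N (v 3)]

noncomputable def d0 : funRep k D M 1 ⟶ funRep k D M 2 := mkHom 1 2 F0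
  (by intro v w i; fin_cases i <;> simp [F0] <;> abel)
  (by intro c v i; fin_cases i <;> simp [F0, T_smul, S_smul, smul_sub])
  (by intro g v i; fin_cases i <;> simp [F0, T_R, S_R, R_sub])

noncomputable def d1 : funRep k D M 2 ⟶ funRep k D M 3 := mkHom 2 3 F1
  (by intro v w i; fin_cases i <;> simp [F1] <;> abel)
  (by intro c v i; fin_cases i <;> simp [F1, T_smul, S_smul, Sr_smul, N_smul] <;> module)
  (by intro g v i; fin_cases i <;> simp [F1, T_R, S_R, Sr_R, N_R, R_sub, R_add, R_neg])

noncomputable def d2 : funRep k D M 3 ⟶ funRep k D M 4 := mkHom 3 4 F2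
  (by intro v w i; fin_cases i <;> simp [F2] <;> abel)
  (by intro c v i; fin_cases i <;> simp [F2, T_smul, S_smul, Sr_smul, N_smul] <;> module)
  (by intro g v i; fin_cases i <;> simp [F2, T_R, S_R, Sr_R, N_R, R_sub, R_add, R_neg])

noncomputable def d3 : funRep k D M 4 ⟶ funRep k D M 5 := mkHom 4 5 F3
  (by intro v w i; fin_cases i <;> simp [F3] <;> abel)
  (by intro c v i; fin_cases i <;> simp [F3, T_smul, S_smul, Sr_smul, N_smul] <;> module)
  (by intro g v i; fin_cases i <;> simp [F3, T_R, S_R, Sr_R, N_R, R_sub, R_add, R_neg])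

noncomputable def eps : Rep.trivial k D M ⟶ funRep k D M 1 :=
  Rep.ofHom ⟨{ toFun := fun a _ _ => a
               map_add' := fun _ _ => rfl
               map_smul' := fun _ _ => rfl }, fun g => by ext; rfl⟩

lemma d1F0 (v : Fin 1 → D → M) : F1 (F0 v) = 0 := by
  ext1 i; fin_cases i <;> simp [F0, F1, TS, SrT, SS, SrSr, NSr, TN, NT] <;> abel

lemma d2F1 (v : Fin 2 → D → M) : F2 (F1 v) = 0 := by
  ext1 i; fin_cases i <;> simp [F2, F1, TS, SrT, SS, SrSr, NSr, TN, NT] <;> abel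

lemma d3F2 (v : Fin 3 → D → M) : F3 (F2 v) = 0 := by
  ext1 i; fin_cases i <;> simp [F2, F3, TS, SrT, SS, SrSr, NSr, TN, NT] <;> abel

lemma exF0 (v : Fin 1 → D → M) (hv : F0 v = 0) : ∃ a : M, (fun _ _ => a) = v := by
  have h0 : S (v 0) - v 0 = 0 := congrFun hv 0
  have h1 : T (v 0) - v 0 = 0 := congrFun hv 1
  refine ⟨v 0 1, ?_⟩
  ext i h
  obtain rfl : i = 0 := Subsingleton.elim _ _
  exact (ex0 _ h1 h0 h).symm

lemma exF1 (v : Fin 2 → D → M) (hv : F1 v = 0) : ∃ w, F0 w = v := by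
  have h0 : S (v 0) + v 0 = 0 := congrFun hv 0
  have h1 : -(T (v 0) - v 0) + (-Sr (v 1) - v 1) = 0 := congrFun hv 1
  have h2 : N (v 1) = 0 := congrFun hv 2
  obtain ⟨u, hu⟩ := exT _ h2
  rw [← hu] at h1
  simp only [map_sub, SrT] at h1
  obtain ⟨w, hw, hww⟩ := exSm (v 0 - (S u - u))
    (by simp only [map_sub, TS]; linear_combination (norm := module) - h1)
    (by simp only [map_sub, SS]; linear_combination (norm := module) h0)
  refine ⟨![u + w], ?_⟩
  ext1 i; fin_cases i
  · change S (u + w) - (u + w) = v 0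
    simp only [map_add]
    linear_combination (norm := module) hww
  · change T (u + w) - (u + w) = v 1
    simp only [map_add]
    linear_combination (norm := module) hw + hu

lemma exF2 (v : Fin 3 → D → M) (hv : F2 v = 0) : ∃ w, F1 w = v := by
  have h0 : S (v 0) - v 0 = 0 := congrFun hv 0
  have h1 : (T (v 0) - v 0) + (-Sr (v 1) + v 1) = 0 := congrFun hv 1
  have h2 : -N (v 1) + (-S (v 2) - v 2) = 0 := congrFun hv 2
  have h3 : T (v 2) - v 2 = 0 := congrFun hv 3
  obtain ⟨y, hy⟩ := exN _ h3
  rw [← hy] at h2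
  obtain ⟨u, hu⟩ := exT (v 1 + Sr y + y)
    (by simp only [map_add, NSr]; linear_combination (norm := module) - h2)
  have hb : v 1 = T u - u - Sr y - y := by linear_combination (norm := module) - hu
  rw [hb] at h1
  simp only [map_sub, SrT, SrSr] at h1
  obtain ⟨w, hw, hww⟩ := exSp (v 0 + S u + u)
    (by simp only [map_add, TS]; linear_combination (norm := module) h1)
    (by simp only [map_add, SS]; linear_combination (norm := module) h0)
  refine ⟨![w - u, y], ?_⟩
  ext1 i; fin_cases i
  · change S (w - u) + (w - u) = v 0
    simp only [map_sub]
    linear_combination (norm := module) hww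
  · change -(T (w - u) - (w - u)) + (-Sr y - y) = v 1
    simp only [map_sub]
    linear_combination (norm := module) hu - hw
  · exact hy

lemma exF3 (v : Fin 4 → D → M) (hv : F3 v = 0) : ∃ w, F2 w = v := by
  have h0 : S (v 0) + v 0 = 0 := congrFun hv 0
  have h1 : -(T (v 0) - v 0) + (-Sr (v 1) - v 1) = 0 := congrFun hv 1
  have h2 : N (v 1) + (-S (v 2) + v 2) = 0 := congrFun hv 2
  have h3 : -(T (v 2) - v 2) + (Sr (v 3) - v 3) = 0 := congrFun hv 3
  have h4 : N (v 3) = 0 := congrFun hv 4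
  obtain ⟨x, hx⟩ := exT _ h4
  rw [← hx] at h3
  simp only [map_sub, SrT] at h3
  obtain ⟨y, hy⟩ := exN (v 2 + S x + x)
    (by simp only [map_add, TS]; linear_combination (norm := module) - h3)
  have hc : v 2 = N y - S x - x := by linear_combination (norm := module) - hy
  rw [hc] at h2
  simp only [map_sub, SS] at h2
  obtain ⟨z, hz⟩ := exT (v 1 - Sr y + y)
    (by simp only [map_add, map_sub, NSr]; linear_combination (norm := module) h2)
  have hb : v 1 = T z - z + Sr y - y := by linear_combination (norm := module) - hz
  rw [hb] at h1
  simp only [map_sub, map_add, SrT, SrSr] at h1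
  obtain ⟨w, hw, hww⟩ := exSm (v 0 - (S z - z))
    (by simp only [map_sub, TS]; linear_combination (norm := module) - h1)
    (by simp only [map_sub, SS]; linear_combination (norm := module) h0)
  refine ⟨![z + w, -y, x], ?_⟩
  ext1 i; fin_cases i
  · change S (z + w) - (z + w) = v 0
    simp only [map_add]
    linear_combination (norm := module) hww
  · change (T (z + w) - (z + w)) + (-Sr (-y) + -y) = v 1
    simp only [map_add, map_neg]
    linear_combination (norm := module) hz + hw
  · change -N (-y) + (-S x - x) = v 2
    simp only [map_neg]
    linear_combination (norm := module) hy
  · exact hx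

theorem shiftD (k : Type) [CommRing k] (M : Type) [AddCommGroup M] [Module k M] :
    ∃ φ : (kerRep (d3 (k := k) (M := M))).ρ.invariants →+
      groupCohomology (Rep.trivial k D M) 3, Function.Surjective φ ∧
      ∀ z, φ z = 0 ↔ ∃ w : (funRep k D M 3).ρ.invariants, F2 w.1 = z.1.1 := by
  refine shift eps d0 d1 d2 d3 ?_ d1F0 d2F1 d3F2 ?_ exF0 exF1 exF2 exF3
    (acyclic_fun _ _) (acyclic_fun _ _) (acyclic_fun _ _)
  · intro a
    change F0 (fun _ _ => a) = 0
    ext i h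
    fin_cases i <;> exact sub_self a
  · intro a b h
    exact congrFun (congrFun h 0) 1

/-- constant function -/
def cst (a : M) : D → M := fun _ => a

lemma T_cst (a : M) : T (cst a) = cst a := rfl
lemma S_cst (a : M) : S (cst a) = cst a := rfl
lemma Sr_cst (a : M) : Sr (cst a) = cst a := rfl
lemma N_cst (a : M) : N (cst a) = cst (a + a + a + a) := rfl
lemma cst_add (a b : M) : cst (a + b) = cst a + cst b := rfl
lemma cst_neg (a : M) : cst (-a) = -cst a := rfl
lemma cst_zero : cst (0 : M) = 0 := rfl
lemma cst_inj {a b : M} (h : cst a = cst b) : a = b := congrFun h 1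

lemma eq_cst {n : ℕ} (w : (funRep k D M n).ρ.invariants) (i : Fin n) :
    w.1 i = cst (w.1 i 1) := by
  ext h
  have := congrFun (congrFun (w.2 h) i) 1
  change w.1 i (1 * h) = w.1 i 1 at this
  rwa [one_mul] at this

lemma eq_cst' {n m : ℕ} {d : funRep k D M n ⟶ funRep k D M m} (z : (kerRep d).ρ.invariants)
    (i : Fin n) : z.1.1 i = cst (z.1.1 i 1) := by
  ext h
  have := congrFun (congrFun (congrArg Subtype.val (z.2 h)) i) 1
  change z.1.1 i (1 * h) = z.1.1 i 1 at this
  rwa [one_mul] at this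

lemma F2_cst (a b c : M) : F2 ![cst a, cst b, cst c] =
    ![0, 0, -cst (b + b + b + b) + (-cst c - cst c), 0] := by
  ext1 i; fin_cases i <;> simp [F2, T_cst, S_cst, Sr_cst, N_cst]

/-- The explicit invariant cocycle. -/
def zz (a b c : M) : Fin 4 → D → M := ![cst a, cst b, 0, cst c]

lemma F3_zz (a b c : M) (ha : a + a = 0) (hb : b + b = 0) (hc : c + c + c + c = 0) :
    F3 (zz a b c) = 0 := by
  have hb2 : -cst b - cst b = 0 := by
    rw [← neg_add', ← cst_add, hb]; simp [cst_zero]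
  ext1 i
  fin_cases i
  · simp [F3, zz, S_cst, ← cst_add, ha, cst_zero]
  · simp [F3, zz, T_cst, Sr_cst, hb2]
  · simp [F3, zz, N_cst, hb, cst_zero, add_assoc]
  · simp [F3, zz, Sr_cst]
  · simp [F3, zz, N_cst, hc, cst_zero]

theorem final (k : Type) [CommRing k] (M : Type) [AddCommGroup M] [Module k M]
    (hdiv : ∀ a : M, ∃ b, b + b = a) (α : ZMod 4 →+ M) (β : ZMod 2 →+ M)
    (iα : Function.Injective α) (iβ : Function.Injective β)
    (sα : ∀ a : M, a + a + a + a = 0 → ∃ x, α x = a) (sβ : ∀ a : M, a + a = 0 → ∃ x, β x = a) :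
    Nonempty (groupCohomology (Rep.trivial k D M) 3 ≃+ ZMod 4 × ZMod 2 × ZMod 2) := by
  obtain ⟨φ, hs, hk⟩ := shiftD k M
  have kα : ∀ x, α x + α x + α x + α x = 0 := by
    intro x
    rw [← map_add, ← map_add, ← map_add, ← map_zero α]
    congr 1
    revert x; decide
  have kβ : ∀ x, β x + β x = 0 := by
    intro x
    rw [← map_add, ← map_zero β]
    congr 1
    revert x; decide
  let Z : ZMod 4 × ZMod 2 × ZMod 2 →+ (kerRep (d3 (k := k) (M := M))).ρ.invariants :=
    { toFun := fun x => ⟨⟨zz (β x.2.1) (β x.2.2) (α x.1), F3_zz _ _ _ (kβ _) (kβ _) (kα _)⟩, by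
        intro g
        apply Subtype.ext
        ext1 i
        fin_cases i <;> rfl⟩
      map_zero' := by
        apply Subtype.ext
        apply Subtype.ext
        change zz _ _ _ = 0
        ext1 i
        fin_cases i <;> simp [zz, cst_zero]
      map_add' := by
        intro x y
        apply Subtype.ext
        apply Subtype.ext
        change zz _ _ _ = zz _ _ _ + zz _ _ _
        ext1 i
        fin_cases i <;> simp [zz, cst_add] }
  have hZ : ∀ x, (Z x).1.1 = zz (β x.2.1) (β x.2.2) (α x.1) := fun _ => rfl
  refine ⟨(AddEquiv.ofBijective (φ.comp Z) ⟨?_, ?_⟩).symm⟩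
  · rw [injective_iff_map_eq_zero]
    intro x hx
    obtain ⟨w, hw⟩ := (hk _).1 hx
    rw [hZ] at hw
    have hw3 : w.1 = ![cst (w.1 0 1), cst (w.1 1 1), cst (w.1 2 1)] := by
      ext1 i
      fin_cases i
      · exact eq_cst w 0
      · exact eq_cst w 1
      · exact eq_cst w 2
    rw [hw3, F2_cst] at hw
    have e0 : (0 : M) = β x.2.1 := congrFun (congrFun hw 0) 1
    have e1 : (0 : M) = β x.2.2 := congrFun (congrFun hw 1) 1
    have e3 : (0 : M) = α x.1 := congrFun (congrFun hw 3) 1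
    exact Prod.ext (iα (by rw [← e3]; simp)) (Prod.ext (iβ (by rw [← e0]; simp))
      (iβ (by rw [← e1]; simp)))
  · intro y
    obtain ⟨z, rfl⟩ := hs y
    have hz : F3 z.1.1 = 0 := z.1.2
    obtain ⟨a, ha⟩ : ∃ a, z.1.1 0 = cst a := ⟨_, eq_cst' z 0⟩
    obtain ⟨b, hb⟩ : ∃ a, z.1.1 1 = cst a := ⟨_, eq_cst' z 1⟩
    obtain ⟨c, hc⟩ : ∃ a, z.1.1 2 = cst a := ⟨_, eq_cst' z 2⟩
    obtain ⟨d, hd⟩ : ∃ a, z.1.1 3 = cst a := ⟨_, eq_cst' z 3⟩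
    have h0 : S (z.1.1 0) + z.1.1 0 = 0 := congrFun hz 0
    have h1 : -(T (z.1.1 0) - z.1.1 0) + (-Sr (z.1.1 1) - z.1.1 1) = 0 := congrFun hz 1
    have h4 : N (z.1.1 3) = 0 := congrFun hz 4
    rw [ha, S_cst, ← cst_add] at h0
    rw [ha, hb, Sr_cst, T_cst, sub_self, neg_zero, zero_add, ← neg_add', neg_eq_zero,
      ← cst_add] at h1
    rw [hd, N_cst] at h4
    obtain ⟨xa, hxa⟩ := sβ a (cst_inj h0)
    obtain ⟨xb, hxb⟩ := sβ b (cst_inj h1)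
    obtain ⟨xd, hxd⟩ := sα d (cst_inj h4)
    obtain ⟨e, he⟩ := hdiv c
    refine ⟨(xd, xa, xb), ?_⟩
    change φ (Z _) = φ z
    rw [← sub_eq_zero, ← map_sub, hk]
    refine ⟨⟨![cst 0, cst 0, cst e], ?_⟩, ?_⟩
    · intro g
      ext1 i
      fin_cases i <;> rfl
    · change F2 _ = (Z _).1.1 - z.1.1
      rw [hZ, F2_cst]
      ext1 i
      fin_cases i
      · simp [zz, ha, hxa]
      · simp [zz, hb, hxb]
      · simp [zz, hc, ← he, cst_add, cst_zero, sub_eq_add_neg]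
      · simp [zz, hd, hxd]

lemma zmod_hom (n : ℕ) [NeZero n] : ∃ α : ZMod n →+ Additive ℂˣ, Function.Injective α ∧
    ∀ a : Additive ℂˣ, n • a = 0 → ∃ x, α x = a := by
  have hp := Complex.isPrimitiveRoot_exp n (NeZero.ne n)
  obtain ⟨ζ, hζ⟩ : ∃ ζ : ℂˣ, IsPrimitiveRoot ζ n :=
    ⟨hp.toRootsOfUnity.1, IsPrimitiveRoot.coe_units_iff.1 (by simpa using hp)⟩
  let e := hζ.zmodEquivZPowers
  refine ⟨(Subgroup.subtype _).toAdditive.comp e.toAddMonoidHom, ?_, ?_⟩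
  · exact Subtype.val_injective.comp e.injective
  · intro a ha
    have h1 : Additive.toMul a ∈ rootsOfUnity n ℂ := by
      rw [mem_rootsOfUnity]; exact ha
    rw [← hζ.zpowers_eq] at h1
    exact ⟨e.symm (Additive.ofMul ⟨_, h1⟩), by simp⟩

end Dihedral
end D8

/-- The group cohomology `H³(D₈, ℂˣ)` of the dihedral group of order 8 with
coefficients in the trivial module `ℂˣ` is isomorphic, as an abelian group,
to `ℤ/4ℤ × ℤ/2ℤ × ℤ/2ℤ`. -/
theorem groupCohomology_three_dihedral_eight :
    Nonempty
      ((groupCohomology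
        (Rep.trivial ℤ (DihedralGroup 4) (Additive ℂˣ)) 3) ≃+
        (ZMod 4 × ZMod 2 × ZMod 2)) := by
  obtain ⟨α, iα, sα⟩ := D8.zmod_hom 4
  obtain ⟨β, iβ, sβ⟩ := D8.zmod_hom 2
  refine D8.final ℤ (Additive ℂˣ) ?_ α β iα iβ ?_ ?_
  · intro a
    obtain ⟨z, hz⟩ := IsAlgClosed.exists_pow_nat_eq ((Additive.toMul a : ℂˣ) : ℂ) (n := 2) two_pos
    have hz0 : z ≠ 0 := by
      rintro rfl
      exact (Additive.toMul a).ne_zero (by rw [← hz]; simp)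
    refine ⟨Additive.ofMul (Units.mk0 z hz0), ?_⟩
    apply Additive.toMul.injective
    apply Units.ext
    rw [← hz, pow_two]
    rfl
  · intro a ha
    exact sα a (by rw [← ha]; abel)
  · intro a ha
    exact sβ a (by rw [← ha]; abel)
end

section
/- The group cohomology H^3(Q_8, ℂ^×) of the quaternion group Q_8 of order 8 with coefficients in the trivial module ℂ^× is isomorphic as an abelian group to ℤ/8ℤ. -/
namespace QEight

open CategoryTheory Matrix

/-- The quaternion group of order 8. -/
abbrev Q := QuaternionGroup 2

/-- Numbering of the elements of the quaternion group. -/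
def enc : Q → ℕ
  | .a i => ZMod.val i
  | .xa i => 4 + ZMod.val i

/-- Numbering of the basis `Fin n × Q`. -/
def idx {n : ℕ} (p : Fin n × Q) : ℕ := 8 * p.1.val + enc p.2

/-- The matrix with given sparse rows. -/
def tab (L : List (List (ℕ × ℤ))) (m n : ℕ) : Matrix (Fin m × Q) (Fin n × Q) ℤ :=
  fun p q => ((L.getD (idx p) []).lookup (idx q)).getD 0

/-- The matrix over `ℤ` of a matrix over the group ring (acting on row vectors). -/
def grp {m n : ℕ} (c : Fin m → Fin n → Q → ℤ) : Matrix (Fin m × Q) (Fin n × Q) ℤ :=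
  fun p q => c p.1 q.1 (p.2⁻¹ * q.2)

/-- The group ring element `∑ c_i g_i`. -/
def el (L : List (Q × ℤ)) (g : Q) : ℤ := (L.lookup g).getD 0

/-- first generator -/
def qx : Q := .a 1
/-- second generator -/
def qy : Q := .xa 0

/-- First differential. -/
def c1 : Fin 2 → Fin 1 → Q → ℤ := fun i _ =>
  if i = 0 then el [(qx, 1), (1, -1)] else el [(qy, 1), (1, -1)]

/-- Second differential. -/
def c2 : Fin 2 → Fin 2 → Q → ℤ := fun i j =>
  if i = 0 then (if j = 0 then el [(1, 1), (qx, 1)] else el [(qy, -1), (1, -1)])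
  else (if j = 0 then el [(qx * qy, 1), (1, 1)] else el [(qx, 1), (1, -1)])

/-- Third differential. -/
def c3 : Fin 1 → Fin 2 → Q → ℤ := fun _ j =>
  if j = 0 then el [(qx, 1), (1, -1)] else el [(1, 1), (qx * qy, -1)]

/-- Fourth differential: the norm. -/
def c4 : Fin 1 → Fin 1 → Q → ℤ := fun _ _ _ => 1

/-- Sparse rows of a piece of the contracting homotopy. -/
def sT0 : List (List (ℕ × ℤ)) :=
   [[],
    [(0, 1)],
    [(0, 1), (1, 1)],
    [(0, 1), (1, 1), (2, 1)],
    [(0, 1), (1, 1), (2, 1), (4, -1), (11, 1)],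
    [(0, 1), (1, 1), (2, 1), (11, 1)],
    [(0, 1), (1, 1), (2, 1), (5, 1), (11, 1)],
    [(0, 1), (1, 1), (2, 1), (5, 1), (6, 1), (11, 1)]]

/-- Sparse rows of a piece of the contracting homotopy. -/
def sT1 : List (List (ℕ × ℤ)) :=
   [[],
    [],
    [],
    [(0, 1), (4, -1), (10, 1), (11, 1)],
    [],
    [],
    [],
    [(2, -1), (6, 1), (10, 1), (11, 1)],
    [(0, -1), (4, 1), (10, -1)],
    [(1, -1), (2, 1), (6, -1), (7, 1), (10, -1), (11, -1)],
    [(10, -1)],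
    [],
    [(4, -1), (10, 1)],
    [(1, 1), (2, -1), (5, -1), (6, 1), (7, -1), (10, 1), (11, 1)],
    [(0, 1), (2, -1), (4, -1), (10, 2), (11, 1)],
    [(2, -1), (6, 1), (7, -1), (10, 1), (11, 1)]]

/-- Sparse rows of a piece of the contracting homotopy. -/
def sT2 : List (List (ℕ × ℤ)) :=
   [[],
    [],
    [],
    [(1, -1), (3, -1), (4, -1), (6, -1)],
    [],
    [],
    [],
    [],
    [(1, -1), (2, -1), (3, -1), (4, -1), (5, -1), (6, -1)],
    [(1, 1), (6, 1)],
    [],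
    [],
    [(1, 1), (4, 1), (6, 1)],
    [(1, -1), (2, -1), (3, -1), (4, -1), (6, -1)],
    [(6, 1)],
    [(0, -1), (1, -1), (2, -1), (3, -1), (4, -1), (5, -1), (6, -1)]]

/-- Sparse rows of a piece of the contracting homotopy. -/
def sT3 : List (List (ℕ × ℤ)) :=
   [[],
    [],
    [],
    [],
    [],
    [],
    [],
    [(0, 1)]]

/-- Sparse rows of a piece of the contracting homotopy. -/
def sU0 : List (List (ℕ × ℤ)) :=
   [[(0, 1)],
    [],
    [],
    [],
    [],
    [],
    [],
    []]

/-- Sparse rows of a piece of the contracting homotopy. -/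
def sU1 : List (List (ℕ × ℤ)) :=
   [[(0, -1)],
    [],
    [(1, 1)],
    [(1, 1), (2, 1)],
    [(1, 1), (2, 1), (4, -1), (11, 1)],
    [(1, 1), (2, 1), (11, 1)],
    [(1, 1), (2, 1), (5, 1), (11, 1)],
    [(1, 1), (2, 1), (5, 1), (6, 1), (11, 1)]]

/-- Sparse rows of a piece of the contracting homotopy. -/
def sU2 : List (List (ℕ × ℤ)) :=
   [[(0, 1), (2, -1), (4, -1), (10, 1), (11, 1)],
    [],
    [(1, 1)],
    [(1, -1), (2, 1)],
    [(1, 1), (2, -1), (11, 1)],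
    [(1, -1), (10, 1)],
    [(1, 1), (2, -1), (6, 1), (7, -1), (11, 1)],
    [(1, -1), (2, 1), (7, 1), (11, -1)],
    [],
    [],
    [],
    [],
    [(2, -1), (4, -1), (10, 1), (11, 1)],
    [(2, -1), (5, -1), (6, 1), (7, -1), (10, 1), (11, 1)],
    [],
    []]

/-- Sparse rows of a piece of the contracting homotopy. -/
def sU3 : List (List (ℕ × ℤ)) :=
   [[(0, -1)],
    [],
    [(1, 1)],
    [(0, -1), (3, -1)],
    [(4, -1)],
    [],
    [(5, 1)],
    [(5, 1), (6, 1)],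
    [],
    [],
    [(0, 1), (1, 1), (2, 1), (3, 1)],
    [],
    [],
    [],
    [],
    []]

theorem sq21 : grp c2 * grp c1 = 0 := by decide +kernel
theorem sq32 : grp c3 * grp c2 = 0 := by decide +kernel
theorem sq43 : grp c4 * grp c3 = 0 := by decide +kernel
theorem sq14 : grp c1 * grp c4 = 0 := by decide +kernel

theorem ht0 : tab sT0 1 2 * grp c1 + grp c4 * tab sU0 1 1 = 1 := by decide +kernel
theorem ht1 : tab sT1 2 2 * grp c2 + grp c1 * tab sU1 1 2 = 1 := by decide +kernel
theorem ht2 : tab sT2 2 1 * grp c3 + grp c2 * tab sU2 2 2 = 1 := by decide +kernel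
theorem ht3 : tab sT3 1 1 * grp c4 + grp c3 * tab sU3 2 1 = 1 := by decide +kernel

/-- The free module of rank `n`. -/
noncomputable abbrev P (n : ℕ) : Rep ℤ Q := Rep.free ℤ Q (Fin n)

/-- Coordinates. -/
noncomputable def coord {n : ℕ} (x : Fin n →₀ MonoidAlgebra ℤ Q) : Fin n × Q → ℤ :=
  fun p => (x p.1).coeff p.2

theorem coord_add {n : ℕ} (x y : Fin n →₀ MonoidAlgebra ℤ Q) :
    coord (x + y) = coord x + coord y := by
  ext p; simp [coord]

/-- The element with given coordinates. -/
noncomputable def uncoord {n : ℕ} (v : Fin n × Q → ℤ) : Fin n →₀ MonoidAlgebra ℤ Q :=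
  ∑ p, Finsupp.single p.1 (MonoidAlgebra.single p.2 (v p))

theorem coord_single {n : ℕ} (i : Fin n) (g : Q) (r : ℤ) :
    coord (Finsupp.single i (MonoidAlgebra.single g r)) = Pi.single (i, g) r := by
  ext ⟨j, h⟩
  by_cases hi : i = j
  · subst hi
    by_cases hg : g = h
    · subst hg
      simp [coord]
    · simp [coord, Ne.symm hg]
  · have : j ≠ i := fun h => hi h.symm
    simp [coord, this]

/-- Coordinates as an additive map. -/
noncomputable def coordHom (n : ℕ) : (Fin n →₀ MonoidAlgebra ℤ Q) →+ (Fin n × Q → ℤ) :=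
  AddMonoidHom.mk' coord coord_add

theorem coord_zero {n : ℕ} : coord (0 : Fin n →₀ MonoidAlgebra ℤ Q) = 0 :=
  (coordHom n).map_zero

theorem coord_uncoord {n : ℕ} (v : Fin n × Q → ℤ) : coord (uncoord v) = v := by
  change coordHom n (uncoord v) = v
  rw [uncoord, map_sum]
  change ∑ p : Fin n × Q, coord _ = v
  simp only [coord_single]
  exact Finset.univ_sum_single v

theorem coord_injective {n : ℕ} : Function.Injective (coord (n := n)) := by
  intro x y h
  ext i g
  exact congrFun h (i, g)

/-- The map of free modules given by a matrix over the group ring. -/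
noncomputable def toMap {m n : ℕ} (c : Fin m → Fin n → Q → ℤ) :
    (Representation.free ℤ Q (Fin m)).IntertwiningMap (Representation.free ℤ Q (Fin n)) :=
  Representation.freeLift _ (fun i => uncoord (fun q => c i q.1 q.2))

/-- The map of free modules given by a matrix over the group ring, as a morphism. -/
noncomputable def toHom {m n : ℕ} (c : Fin m → Fin n → Q → ℤ) : P m ⟶ P n :=
  Rep.ofHom (toMap c)

theorem toMap_single {m n : ℕ} (c : Fin m → Fin n → Q → ℤ) (i : Fin m) (g : Q) (r : ℤ) :
    toMap c (Finsupp.single i (MonoidAlgebra.single g r)) =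
      r • Representation.free ℤ Q (Fin n) g (uncoord (fun q => c i q.1 q.2)) := by
  rw [toMap, Representation.freeLift_single_single]

theorem toHom_gen {m n : ℕ} (c : Fin m → Fin n → Q → ℤ) (i : Fin m) :
    (toHom c).hom (Finsupp.single i (MonoidAlgebra.single 1 1)) =
      uncoord (fun q => c i q.1 q.2) := by
  change toMap c _ = _
  rw [toMap_single, one_smul, map_one]
  rfl

theorem rho_uncoord {n : ℕ} (g : Q) (v : Fin n × Q → ℤ) :
    Representation.free ℤ Q (Fin n) g (uncoord v) = uncoord (fun q => v (q.1, g⁻¹ * q.2)) := by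
  rw [uncoord, map_sum, uncoord]
  refine Fintype.sum_equiv ((Equiv.refl _).prodCongr (Equiv.mulLeft g)) _ _ ?_
  rintro ⟨i, h⟩
  simp

theorem coord_toMap {m n : ℕ} (c : Fin m → Fin n → Q → ℤ) (x : Fin m →₀ MonoidAlgebra ℤ Q) :
    coord (toMap c x) = coord x ᵥ* grp c := by
  induction x using Finsupp.induction_linear with
  | zero => rw [map_zero, coord_zero, coord_zero, Matrix.zero_vecMul]
  | add x y hx hy => rw [map_add, coord_add, coord_add, Matrix.add_vecMul, ← hx, ← hy]
  | single i x =>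
    induction x using MonoidAlgebra.induction_linear with
    | zero => rw [Finsupp.single_zero, map_zero, coord_zero, coord_zero, Matrix.zero_vecMul]
    | add x y hx hy =>
      rw [Finsupp.single_add, map_add, coord_add, coord_add, Matrix.add_vecMul, ← hx, ← hy]
    | single g r =>
      rw [toMap_single, rho_uncoord, coord_single]
      refine ((coordHom n).map_zsmul r _).trans ?_
      change r • coord _ = _
      rw [coord_uncoord, Matrix.single_vecMul]
      rfl

theorem coord_toHom {m n : ℕ} (c : Fin m → Fin n → Q → ℤ) (x : Fin m →₀ MonoidAlgebra ℤ Q) :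
    coord ((toHom c).hom x) = coord x ᵥ* grp c := coord_toMap c x

theorem toHom_comp {l m n : ℕ} (c : Fin l → Fin m → Q → ℤ) (d : Fin m → Fin n → Q → ℤ)
    (h : grp c * grp d = 0) : toHom c ≫ toHom d = 0 := by
  apply Rep.free_ext
  intro i
  apply coord_injective
  change coord ((toHom d).hom ((toHom c).hom _)) = coord 0
  rw [coord_toHom, coord_toHom, Matrix.vecMul_vecMul, h, Matrix.vecMul_zero, coord_zero]

theorem toHom_exact {l m n : ℕ} (c : Fin l → Fin m → Q → ℤ) (d : Fin m → Fin n → Q → ℤ)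
    (T : Matrix (Fin m × Q) (Fin l × Q) ℤ) (U : Matrix (Fin n × Q) (Fin m × Q) ℤ)
    (h : T * grp c + grp d * U = 1) (x : Fin m →₀ MonoidAlgebra ℤ Q)
    (hx : (toHom d).hom x = 0) : ∃ y, (toHom c).hom y = x := by
  refine ⟨uncoord (coord x ᵥ* T), coord_injective ?_⟩
  rw [coord_toHom, coord_uncoord, Matrix.vecMul_vecMul]
  have h2 : coord x ᵥ* grp d = 0 := by
    rw [← coord_toHom d x, hx]
    exact coord_zero
  have h3 : coord x ᵥ* (T * grp c + grp d * U) = coord x := by rw [h, Matrix.vecMul_one]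
  rwa [Matrix.vecMul_add, ← Matrix.vecMul_vecMul _ (grp d), h2, Matrix.zero_vecMul,
    add_zero] at h3

/-- Terms of the resolution. -/
noncomputable def X : ℕ → Rep ℤ Q
  | 0 => P 1
  | 1 => P 2
  | 2 => P 2
  | 3 => P 1
  | n + 4 => X n

/-- Differentials of the resolution. -/
noncomputable def d : (n : ℕ) → (X (n + 1) ⟶ X n)
  | 0 => toHom c1
  | 1 => toHom c2
  | 2 => toHom c3
  | 3 => toHom c4
  | n + 4 => d n

theorem d_sq : ∀ n, d (n + 1) ≫ d n = 0
  | 0 => toHom_comp _ _ sq21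
  | 1 => toHom_comp _ _ sq32
  | 2 => toHom_comp _ _ sq43
  | 3 => toHom_comp _ _ sq14
  | n + 4 => d_sq n

theorem d_exact : ∀ n, ∀ x : (X (n + 1)).V, (d n).hom x = 0 → ∃ y, (d (n + 1)).hom y = x
  | 0 => toHom_exact _ _ _ _ ht1
  | 1 => toHom_exact _ _ _ _ ht2
  | 2 => toHom_exact _ _ _ _ ht3
  | 3 => toHom_exact _ _ _ _ ht0
  | n + 4 => d_exact n

theorem X_proj : ∀ n, Projective (X n)
  | 0 => inferInstanceAs (Projective (P 1))
  | 1 => inferInstanceAs (Projective (P 2))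
  | 2 => inferInstanceAs (Projective (P 2))
  | 3 => inferInstanceAs (Projective (P 1))
  | n + 4 => X_proj n

/-- The complex. -/
noncomputable abbrev cpx : ChainComplex (Rep ℤ Q) ℕ := ChainComplex.of X d d_sq

/-- The augmentation. -/
noncomputable def eps : P 1 ⟶ Rep.trivial ℤ Q ℤ :=
  Rep.freeLift ℤ Q (A := Rep.trivial ℤ Q ℤ) (fun _ => (1 : ℤ))

theorem eps_single (i : Fin 1) (g : Q) (r : ℤ) :
    eps.hom (Finsupp.single i (MonoidAlgebra.single g r)) = r := by
  refine (Representation.freeLift_single_single _ i g r _).trans ?_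
  simp

theorem eps_eq (x : Fin 1 →₀ MonoidAlgebra ℤ Q) : eps.hom x = ∑ p, coord x p := by
  induction x using Finsupp.induction_linear with
  | zero => rw [map_zero, coord_zero]; simp
  | add x y hx hy => rw [map_add, coord_add, hx, hy]; simp [Finset.sum_add_distrib]
  | single i x =>
    induction x using MonoidAlgebra.induction_linear with
    | zero => rw [Finsupp.single_zero, map_zero, coord_zero]; simp
    | add x y hx hy =>
      rw [Finsupp.single_add, map_add, coord_add, hx, hy]; simp [Finset.sum_add_distrib]
    | single g r =>
      rw [eps_single, coord_single]; simp

theorem d_eps : toHom c1 ≫ eps = 0 := by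
  apply Rep.free_ext
  intro i
  change eps.hom ((toHom c1).hom _) = 0
  rw [eps_eq, coord_toHom, coord_single]
  revert i
  decide +kernel

theorem eps_exact (x : Fin 1 →₀ MonoidAlgebra ℤ Q) (hx : eps.hom x = 0) :
    ∃ y, (toHom c1).hom y = x := by
  refine toHom_exact _ c4 _ _ ht0 x ?_
  apply coord_injective
  rw [coord_toHom]
  refine Eq.trans ?_ coord_zero.symm
  ext q
  rw [eps_eq] at hx
  simpa [Matrix.vecMul, dotProduct, grp, c4] using hx

theorem cpx_d (n : ℕ) : cpx.d (n + 1) n = d n := ChainComplex.of_d X d n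

/-- The augmentation as a chain map. -/
noncomputable def aug : cpx ⟶ (ChainComplex.single₀ (Rep ℤ Q)).obj (Rep.trivial ℤ Q ℤ) :=
  (ChainComplex.toSingle₀Equiv cpx _).symm ⟨eps, by rw [cpx_d]; exact d_eps⟩

theorem rep_exact {k G : Type} [CommRing k] [Group G] (S : ShortComplex (Rep.{0} k G))
    (h : ∀ x : S.X₂, S.g.hom x = 0 → ∃ y : S.X₁, S.f.hom y = x) : S.Exact := by
  apply (forget₂ _ (ModuleCat k)).reflects_exact_of_faithful
  rw [ShortComplex.moduleCat_exact_iff]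
  exact h

theorem aug_quasiIso : QuasiIso aug where
  quasiIsoAt m := by
    cases m with
    | zero =>
      rw [ChainComplex.quasiIsoAt₀_iff, ShortComplex.quasiIso_iff_of_zeros' _ rfl rfl rfl]
      constructor
      · apply rep_exact
        intro (x : Fin 1 →₀ MonoidAlgebra ℤ Q) hx
        obtain ⟨y, hy⟩ := eps_exact x hx
        exact ⟨y, (congrArg (fun f : X 1 ⟶ X 0 => (Rep.Hom.hom f) y) (cpx_d 0)).trans hy⟩
      · rw [Rep.epi_iff_surjective]
        intro x
        exact ⟨Finsupp.single (0 : Fin 1) (MonoidAlgebra.single (1 : Q) x), eps_single _ _ _⟩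
    | succ m =>
      rw [quasiIsoAt_iff_exactAt' (hL := ChainComplex.exactAt_succ_single_obj ..),
          HomologicalComplex.exactAt_iff' _ (m + 2) (m + 1) m (by simp) (by simp)]
      apply rep_exact
      intro x hx
      change Rep.Hom.hom (cpx.d (m + 1) m) x = 0 at hx
      rw [cpx_d] at hx
      obtain ⟨y, hy⟩ := d_exact m x hx
      exact ⟨y, (congrArg (fun f : X (m + 2) ⟶ X (m + 1) => (Rep.Hom.hom f) y)
        (cpx_d (m + 1))).trans hy⟩

/-- The periodic resolution. -/
noncomputable def resn : ProjectiveResolution (Rep.trivial ℤ Q ℤ) where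
  complex := cpx
  projective := X_proj
  π := aug
  quasiIso := aug_quasiIso

/-- The coefficients. -/
noncomputable abbrev A : Rep ℤ Q := Rep.trivial ℤ Q (Additive ℂˣ)

/-- The short complex computing the cohomology. -/
noncomputable abbrev S : ShortComplex (ModuleCat ℤ) :=
  (cpx.linearYonedaObj ℤ A).sc' 2 3 4

theorem hom_uncoord {n : ℕ} (φ : P n ⟶ A) (v : Fin n × Q → ℤ) :
    φ.hom (uncoord v) =
      ∑ p, v p • φ.hom (Finsupp.single p.1 (MonoidAlgebra.single (1 : Q) (1 : ℤ))) := by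
  rw [uncoord, map_sum]
  refine Finset.sum_congr rfl ?_
  rintro ⟨i, g⟩ -
  have h1 : Finsupp.single i (MonoidAlgebra.single g (v (i, g))) =
      v (i, g) • (P n).ρ g (Finsupp.single i (MonoidAlgebra.single (1 : Q) (1 : ℤ))) := by
    simp
  rw [h1, map_zsmul, Rep.hom_comm_apply]
  rfl

theorem sum_zsmul_zero {B : Type} [AddCommGroup B] (f : Q → ℤ) (b : B) (h : ∑ g, f g = 0) :
    ∑ g, f g • b = 0 := by
  rw [← Finset.sum_smul, h, zero_smul]

theorem S_f : S.f = 0 := by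
  ext φ : 2
  revert φ
  change ∀ φ : P 2 ⟶ A, cpx.d 3 2 ≫ φ = 0
  intro φ
  rw [cpx_d]
  apply Rep.free_ext
  intro i
  change φ.hom ((toHom c3).hom _) = 0
  rw [toHom_gen]
  rw [hom_uncoord]
  rw [Fintype.sum_prod_type]
  refine Finset.sum_eq_zero fun j _ => ?_
  have h3 : ∀ i j, ∑ g, c3 i j g = 0 := by decide +kernel
  exact sum_zsmul_zero _ _ (h3 i j)

theorem S_g (φ : P 1 ⟶ A) : S.g φ = 0 ↔
    (8 : ℕ) • φ.hom (Finsupp.single 0 (MonoidAlgebra.single (1 : Q) (1 : ℤ))) = 0 := by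
  have key : (toHom c4 ≫ φ).hom (Finsupp.single 0 (MonoidAlgebra.single (1 : Q) (1 : ℤ))) =
      (8 : ℕ) • φ.hom (Finsupp.single 0 (MonoidAlgebra.single (1 : Q) (1 : ℤ))) := by
    change φ.hom ((toHom c4).hom _) = _
    rw [toHom_gen]
    rw [hom_uncoord, Fintype.sum_prod_type]
    simp [c4, QuaternionGroup.card]
  rw [← key]
  change cpx.d 4 3 ≫ φ = 0 ↔ _
  rw [cpx_d]
  constructor
  · intro h
    change (d 3 ≫ φ).hom _ = 0
    rw [h]
    rfl
  · intro h
    apply Rep.free_ext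
    intro i
    rw [Subsingleton.elim i 0]
    exact h

/-- Evaluation on the generator identifies cocycles with roots of unity. -/
noncomputable def evalHom : LinearMap.ker S.g.hom →+ Additive (rootsOfUnity 8 ℂ) where
  toFun φ := Additive.ofMul ⟨Additive.toMul (Rep.Hom.hom (A := P 1) (B := A) φ.1
    (Finsupp.single 0 (MonoidAlgebra.single (1 : Q) (1 : ℤ)))), (S_g φ.1).1 φ.2⟩
  map_zero' := rfl
  map_add' _ _ := rfl

theorem gen_ext (φ ψ : P 1 ⟶ A)
    (h : φ.hom (Finsupp.single 0 (MonoidAlgebra.single (1 : Q) (1 : ℤ))) =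
      ψ.hom (Finsupp.single 0 (MonoidAlgebra.single (1 : Q) (1 : ℤ)))) : φ = ψ := by
  apply Rep.free_ext
  intro i
  rw [Subsingleton.elim i 0]
  exact h

theorem gen_exists (z : Additive ℂˣ) : ∃ φ : P 1 ⟶ A,
    φ.hom (Finsupp.single 0 (MonoidAlgebra.single (1 : Q) (1 : ℤ))) = z := by
  refine ⟨Rep.ofHom (Representation.freeLift
    (Representation.trivial ℤ Q (Additive ℂˣ)) (fun _ => z)), ?_⟩
  have h := Representation.freeLift_single_single
    (Representation.trivial ℤ Q (Additive ℂˣ)) (0 : Fin 1) 1 1 (fun _ => z)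
  rw [one_smul, map_one] at h
  exact h

theorem evalHom_bijective : Function.Bijective evalHom := by
  constructor
  · intro φ ψ h
    apply Subtype.ext
    exact gen_ext φ.1 ψ.1
      (congrArg (fun z : Additive (rootsOfUnity 8 ℂ) => Additive.ofMul (z.toMul.1)) h)
  · intro z
    obtain ⟨φ, hφ⟩ := gen_exists (Additive.ofMul (z.toMul.1))
    have h8 : (8 : ℕ) • φ.hom (Finsupp.single 0 (MonoidAlgebra.single (1 : Q) (1 : ℤ))) = 0 := by
      rw [hφ]
      exact z.toMul.2
    refine ⟨⟨φ, (S_g φ).2 h8⟩, ?_⟩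
    apply Additive.toMul.injective
    apply Subtype.ext
    exact congrArg Additive.toMul hφ

/-- Roots of unity. -/
theorem roots_equiv : Nonempty (Additive (rootsOfUnity 8 ℂ) ≃+ ZMod 8) := by
  have h : Nat.card (rootsOfUnity 8 ℂ) = Nat.card (Multiplicative (ZMod 8)) := by
    rw [Complex.card_rootsOfUnity]
    simp
  exact ⟨MulEquiv.toAdditiveLeft (mulEquivOfCyclicCardEq h)⟩

/-- Third cohomology is the group of cocycles. -/
noncomputable def cohIso : groupCohomology A 3 ≅ ModuleCat.of ℤ (LinearMap.ker S.g.hom) :=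
  haveI : IsIso S.homologyπ := S.isIso_homologyπ S_f
  groupCohomologyIso A 3 resn ≪≫
    (HomologicalComplex.homologyIsoSc' _ 2 3 4 (by simp) (by simp)) ≪≫
    (asIso S.homologyπ).symm ≪≫ S.moduleCatCyclesIso

end QEight

/-- The group cohomology `H³(Q₈, ℂˣ)` of the quaternion group of order 8 with
coefficients in the trivial module `ℂˣ` is isomorphic, as an abelian group,
to `ℤ/8ℤ`. -/
theorem groupCohomology_three_quaternion_eight :
    Nonempty
      ((groupCohomology
        (Rep.trivial ℤ (QuaternionGroup 2) (Additive ℂˣ)) 3) ≃+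
        ZMod 8) := by
  obtain ⟨e⟩ := QEight.roots_equiv
  exact ⟨QEight.cohIso.toLinearEquiv.toAddEquiv.trans
    ((AddEquiv.ofBijective QEight.evalHom QEight.evalHom_bijective).trans e)⟩
end

section
/- Let G = (ℤ/2ℤ)^3. Consider the action of the automorphism group Aut(G) on H^3(G, ℂ^×) in which φ ∈ Aut(G) sends a cohomology class to its pullback along φ (the map induced on group cohomology by φ, with trivial ℂ^×-coefficients). Then this action has exactly 10 orbits; equivalently, the quotient of H^3(G, ℂ^×) by the equivalence relation a ∼ b ⇔ ∃ φ ∈ Aut(G), φ*(a) = b has exactly 10 elements. -/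
/-- `ω : G³ → ℂˣ` is a 3-cocycle on `G`. -/
def IsThreeCocycle {G : Type} [Group G] (ω : G → G → G → ℂˣ) : Prop :=
  ∀ g h k l : G,
    ω h k l * ω g (h * k) l * ω g h k = ω (g * h) k l * ω g h (k * l)

/-- `β : G³ → ℂˣ` is a 3-coboundary on `G`, i.e. `β = dν` for some 2-cochain
`ν : G² → ℂˣ`. -/
def IsThreeCoboundary {G : Type} [Group G] (β : G → G → G → ℂˣ) : Prop :=
  ∃ ν : G → G → ℂˣ, ∀ g h k : G,
    β g h k = ν h k * ν g (h * k) * (ν (g * h) k)⁻¹ * (ν g h)⁻¹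

/-- The relation on 3-cocycles identifying `a` and `b` whenever the pullback
of `a` along some automorphism `φ` of `G` is cohomologous to `b`; the quotient
of the set of 3-cocycles by (the equivalence closure of) this relation is
exactly the quotient of `H³(G, ℂˣ)` by the pullback action of `Aut(G)`. -/
def AutCohomologousRel {G : Type} [Group G]
    (a b : {ω : G → G → G → ℂˣ // IsThreeCocycle ω}) : Prop :=
  ∃ φ : G ≃* G,
    IsThreeCoboundary (fun g h k => a.1 (φ g) (φ h) (φ k) * (b.1 g h k)⁻¹)

namespace EH3

variable {A B M : Type} [AddCommGroup A] [AddCommGroup B] [AddCommGroup M]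

/-- additive 3-cocycles -/
def C3 (w : A → A → A → M) : Prop :=
  ∀ g h k l, w h k l + w g (h + k) l + w g h k = w (g + h) k l + w g h (k + l)

/-- differential of a 2-cochain -/
def d2 (ν : A → A → M) (g h k : A) : M := ν h k + ν g (h + k) - ν (g + h) k - ν g h

/-- normalized 3-cochains -/
def N3 (w : A → A → A → M) : Prop :=
  (∀ h k, w 0 h k = 0) ∧ (∀ g k, w g 0 k = 0) ∧ (∀ g h, w g h 0 = 0)

/-- trivial restriction to cyclic subgroups -/
def I0 (w : A → A → A → M) : Prop := ∀ g, w g g g + w g 0 g = 0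

/-- detection of cohomology on cyclic subgroups -/
def P (A M : Type) [AddCommGroup A] [AddCommGroup M] : Prop :=
  ∀ w : A → A → A → M, C3 w → I0 w → ∃ ν, ∀ g h k, w g h k = d2 ν g h k

theorem C3_sub {w : A → A → A → M} (hw : C3 w) (ν : A → A → M) :
    C3 (fun g h k => w g h k - d2 ν g h k) := by
  intro g h k l
  have := hw g h k l
  simp only [d2, ← add_assoc] at *
  linear_combination (norm := module) this

theorem I0_sub (hA : ∀ a : A, a + a = 0) {w : A → A → A → M} (hw : I0 w) (ν : A → A → M) :
    I0 (fun g h k => w g h k - d2 ν g h k) := by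
  intro g
  have := hw g
  simp only [d2, hA, add_zero, zero_add] at *
  linear_combination (norm := module) this

theorem N3_sub {w : A → A → A → M} (hw : N3 w) (ν : A → A → M) (h1 : ∀ k, ν 0 k = 0)
    (h2 : ∀ k, ν k 0 = 0) : N3 (fun g h k => w g h k - d2 ν g h k) := by
  obtain ⟨a, b, c⟩ := hw
  refine ⟨?_, ?_, ?_⟩ <;> intros <;> simp [d2, *]

/-- A gauge transformation reduces the problem. -/
theorem reduce {w : A → A → A → M} (ν : A → A → M)
    (h : ∃ ν', ∀ g h k, w g h k - d2 ν g h k = d2 ν' g h k) :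
    ∃ ν, ∀ g h k, w g h k = d2 ν g h k := by
  obtain ⟨ν', h⟩ := h
  refine ⟨fun a b => ν a b + ν' a b, fun g h' k => ?_⟩
  have := h g h' k
  simp only [d2] at *
  linear_combination (norm := module) this

theorem normalize {w : A → A → A → M} (hw : C3 w) :
    ∃ ν, N3 (fun g h k => w g h k - d2 ν g h k) := by
  classical
  refine ⟨fun g h => if g = 0 then w 0 0 h else if h = 0 then - w g 0 0 else 0, ?_⟩
  have h0 : w 0 0 0 = 0 := by
    have := hw 0 0 0 0
    simp only [add_zero] at this
    linear_combination (norm := module) this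
  refine ⟨fun k l => ?_, fun g l => ?_, fun g h => ?_⟩
  · have := hw 0 0 k l
    simp only [d2, add_zero, zero_add, if_true] at *
    linear_combination (norm := module) this
  · have := hw g 0 0 l
    by_cases hg : g = 0
    · subst hg
      simp only [d2, add_zero, if_true, h0] at this ⊢
      linear_combination (norm := module) this
    · simp only [d2, add_zero, zero_add, if_true, hg, if_false] at this ⊢
      linear_combination (norm := module) - this
  · have := hw g h 0 0
    generalize hf : (fun g h : A => if g = 0 then w 0 0 h else if h = 0 then - w g 0 0 else 0) = f
    have e : ∀ x : A, f x 0 = - w x 0 0 := by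
      intro x
      rw [← hf]
      by_cases hx : x = 0 <;> simp [hx, h0]
    simp only [d2, add_zero, e] at this ⊢
    linear_combination (norm := module) this

theorem z2 (i : ZMod 2) : i = 0 ∨ i = 1 := by revert i; decide

theorem z11 : (1 : ZMod 2) + 1 = 0 := by decide

/-- final reduction: cocycles trivialised along the new direction. -/
theorem step1 (w : A × ZMod 2 → A × ZMod 2 → A × ZMod 2 → M)
    (hw : C3 w) (hn : N3 w) (hI : I0 w) :
    ∃ ν : A × ZMod 2 → A × ZMod 2 → M, (∀ k, ν 0 k = 0) ∧ (∀ k, ν k 0 = 0) ∧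
      ∀ h k, w (0, 1) h k = d2 ν (0, 1) h k := by
  obtain ⟨n1, n2, n3⟩ := hn
  have n1' : ∀ h k, w (0, 0) h k = 0 := n1
  have n2' : ∀ h k, w h (0, 0) k = 0 := n2
  have n3' : ∀ h k, w h k (0, 0) = 0 := n3
  have ht : w (0, 1) (0, 1) (0, 1) = 0 := by
    have := hI (0, 1)
    rwa [n2, add_zero] at this
  let lam : A × ZMod 2 → M := fun h => if h.2 = 0 then 0 else w (0, 1) (0, 1) (h.1, 0)
  refine ⟨fun h k => if h.2 = 0 then 0 else lam ((h.1, 0) + k) - w (0, 1) (h.1, 0) k, ?_, ?_, ?_⟩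
  · intro k; simp
  · intro k; simp [lam, n3]
  · rintro ⟨a, i⟩ ⟨b, j⟩
    have A1 := hw (0, 1) (0, 1) (a, 0) (b, j)
    have A2 := hw (0, 1) (0, 1) (0, 1) (a, 0)
    have A3 := hw (0, 1) (0, 1) (0, 1) (a + b, 0)
    rcases z2 i with rfl | rfl <;> rcases z2 j with rfl | rfl <;>
      simp [d2, lam, z11, n1', n2', n3', ht] at * <;> grind

theorem step1' (w : A × ZMod 2 → A × ZMod 2 → A × ZMod 2 → M)
    (hw : C3 w) (h1 : ∀ h k, w (0, 1) h k = 0) (a : A) (i : ZMod 2) (h k : A × ZMod 2) :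
    w (a, i) h k = w (a, 0) h k := by
  have := hw (0, 1) (a, 0) h k
  rcases z2 i with rfl | rfl
  · rfl
  · simp [h1] at this
    exact this.symm

theorem step2 (hdiv : ∀ x : M, ∃ y, y + y = x) (w : A × ZMod 2 → A × ZMod 2 → A × ZMod 2 → M)
    (hw : C3 w) (hn : N3 w) (h1 : ∀ h k, w (0, 1) h k = 0) :
    ∃ ν : A × ZMod 2 → A × ZMod 2 → M, (∀ k, ν 0 k = 0) ∧ (∀ k, ν k 0 = 0) ∧
      (∀ h k, d2 ν (0, 1) h k = 0) ∧ 
      ∀ g k, w g (0, 1) k = d2 ν g (0, 1) k := by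
  classical
  obtain ⟨n1, n2, n3⟩ := hn
  have n1' : ∀ h k, w (0, 0) h k = 0 := n1
  have n2' : ∀ h k, w h (0, 0) k = 0 := n2
  have n3' : ∀ h k, w h k (0, 0) = 0 := n3
  have inv := step1' w hw h1
  have : ∀ a : A, ∃ y, y + y = - w (a, 0) (0, 1) (0, 1) ∧ (a = 0 → y = 0) := by
    intro a
    by_cases ha : a = 0
    · exact ⟨0, by simp [ha, n1'], fun _ => rfl⟩
    · obtain ⟨y, hy⟩ := hdiv (- w (a, 0) (0, 1) (0, 1))
      exact ⟨y, hy, fun h => absurd h ha⟩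
  choose eta he he0 using this
  have he0 := he0 0 rfl
  have key : ∀ a b, w (a, 0) (0, 1) (b, 1) = w (a, 0) (0, 1) (0, 1) - w (a, 0) (0, 1) (b, 0) := by
    intro a b
    have A1 := hw (a, 0) (0, 1) (0, 1) (b, 0)
    have A2 := hw (a, 0) (0, 1) (b, 0) (0, 1)
    simp [z11, inv _ 1, n1', n2', n3', h1] at A1 A2
    grind
  refine ⟨fun g k => if k.2 = 0 then 0 else eta g.1 + w (g.1, 0) (0, 1) (k.1, 0), ?_, ?_, ?_, ?_⟩
  · intro k; simp [he0, n1']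
  · intro k; simp
  · intro h k
    simp [d2, he0, n1']
  · rintro ⟨a, i⟩ ⟨b, j⟩
    have := key a b
    have := he a
    rw [inv a i]
    rcases z2 j with rfl | rfl <;> simp [d2, z11, n1', n2', n3', he0] <;> grind

/-- detection for 2-cocycles -/
def Q (A M : Type) [AddCommGroup A] [AddCommGroup M] : Prop :=
  ∀ p : A → A → M, (∀ g h k, p h k + p g (h + k) = p (g + h) k + p g h) →
    (∀ g, p g 0 = 0) → (∀ g, p 0 g = 0) → (∀ g h, p g h + p g h = 0) → (∀ g, p g g = 0) →
    ∃ m : A → M, (∀ g, m g + m g = 0) ∧ ∀ g h, p g h = m g + m h - m (g + h)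

theorem Q_step (hA : ∀ a : A, a + a = 0) (hQ : Q A M) : Q (A × ZMod 2) M := by
  intro p hc n1 n2 h2 hs
  have n1' : ∀ h, p h (0, 0) = 0 := n1
  have n2' : ∀ h, p (0, 0) h = 0 := n2
  have L1 : ∀ a i h j, p (a, i) (h, j) = p (a, 0) (h, 0) + 
      (if i = 0 then 0 else p (0, 1) (a + h, 0) - p (0, 1) (a, 0)) + 
      (if j = 0 then 0 else p (0, 1) (a + h, 0) - p (0, 1) (h, 0)) := by
    intro a i h j
    have A1 := hc (0, 1) (a, 0) (h, 0)
    have A2 := hc (0, 1) (a, 0) (h, 1)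
    have A3 := hc (0, 1) (0, 1) (a + h, 0)
    have A5 := hc (a, 0) (h, 0) (0, 1)
    have A6 := hc (a, 0) (a, 0) (0, 1)
    have A7 := hc (h, 0) (h, 0) (0, 1)
    have A8 := hc (a + h, 0) (a + h, 0) (0, 1)
    have B6 := hc (0, 1) (a, 0) (a, 1) 
    have B7 := hc (0, 1) (h, 0) (h, 1) 
    have B8 := hc (0, 1) (a + h, 0) (a + h, 1) 
    have C1 := h2 (0, 1) (a, 0)
    have C2 := h2 (0, 1) (h, 0)
    have C3 := h2 (0, 1) (a + h, 0)
    have C4 := h2 (a, 0) (0, 1)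
    have C5 := h2 (h, 0) (0, 1)
    have C6 := h2 (a + h, 0) (0, 1)
    simp only [z11, n1', n2', hs, hA, add_zero, zero_add, Prod.mk_add_mk]
      at A1 A2 A3 A5 A6 A7 A8 B6 B7 B8
    have X : p (a, 0) (h, 1) = p (a, 0) (h, 0) + (p (0, 1) (a + h, 0) - p (0, 1) (h, 0)) := by
      linear_combination (norm := module) A5 + A7 - B7 - C5 - A8 + B8 + C6
    rcases z2 i with rfl | rfl <;> rcases z2 j with rfl | rfl <;>
      simp only [if_true, one_ne_zero, if_false, add_zero]
    · exact X
    · linear_combination (norm := module) - A1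
    · linear_combination (norm := module) X - A2 + A3 - C3
  obtain ⟨m, hm, hp⟩ := hQ (fun a b => p (a, 0) (b, 0))
    (fun g h k => by simpa using hc (g, 0) (h, 0) (k, 0)) (fun g => n1 _) (fun g => n2 _)
    (fun g h => h2 _ _) (fun g => hs _)
  refine ⟨fun g => m g.1 + if g.2 = 0 then 0 else p (0, 1) (g.1, 0), ?_, ?_⟩
  · rintro ⟨a, i⟩
    have := hm a
    have := h2 (0, 1) (a, 0)
    rcases z2 i with rfl | rfl <;> simp <;> grind
  · rintro ⟨a, i⟩ ⟨b, j⟩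
    have C1 := h2 (0, 1) (a, 0)
    have C2 := h2 (0, 1) (b, 0)
    have C3 := h2 (0, 1) (a + b, 0)
    rw [L1, hp]
    rcases z2 i with rfl | rfl <;> rcases z2 j with rfl | rfl <;>
      simp [z11] <;> grind

theorem step3 (hQ : Q A M) (hP : P A M)
    (w : A × ZMod 2 → A × ZMod 2 → A × ZMod 2 → M)
    (hw : C3 w) (hn : N3 w) (hI : I0 w) (h1 : ∀ h k, w (0, 1) h k = 0)
    (h2 : ∀ g k, w g (0, 1) k = 0) : ∃ ν, ∀ g h k, w g h k = d2 ν g h k := by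
  obtain ⟨n1, n2, n3⟩ := hn
  have n1' : ∀ h k, w (0, 0) h k = 0 := n1
  have n2' : ∀ h k, w h (0, 0) k = 0 := n2
  have n3' : ∀ h k, w h k (0, 0) = 0 := n3
  have inv := step1' w hw h1
  have inv2 : ∀ g a i k, w g (a, i) k = w g (a, 0) k := by
    intro g a i k
    have A := hw g (0, 1) (a, 0) k
    have B := inv g.1 (g.2 + 1) (a, 0) k
    have C := inv g.1 g.2 (a, 0) k
    have e : g + (0, 1) = (g.1, g.2 + 1) := by ext <;> simp
    rcases z2 i with rfl | rfl
    · rfl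
    · simp only [e, B, h1, h2, Prod.mk_add_mk, zero_add, add_zero] at A
      rw [A, ← C]
  have inv3 : ∀ a b c, w (a, 0) (b, 0) (c, 1) = w (a, 0) (b, 0) (c, 0) + w (a, 0) (b, 0) (0, 1) := by
    intro a b c
    have A := hw (a, 0) (b, 0) (0, 1) (c, 0)
    simp only [Prod.mk_add_mk, add_zero, zero_add, inv2 _ _ 1, n2'] at A
    exact A.symm
  have two : ∀ a b, w (a, 0) (b, 0) (0, 1) + w (a, 0) (b, 0) (0, 1) = 0 := by
    intro a b
    have A := hw (a, 0) (b, 0) (0, 1) (0, 1)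
    simpa only [Prod.mk_add_mk, add_zero, zero_add, inv2 _ _ 1, z11, n2', n3'] using A
  have sq : ∀ a, w (a, 0) (a, 0) (0, 1) = 0 := by
    intro a
    have A := hI (a, 0)
    have B := hI (a, 1)
    simp only [n2, inv a 1, inv2 _ a 1, add_zero] at A B
    rw [inv3, A, zero_add] at B
    exact B
  obtain ⟨m, hm, hp⟩ := hQ (fun a b => w (a, 0) (b, 0) (0, 1)) (by
    intro g h k
    have A := hw (g, 0) (h, 0) (k, 0) (0, 1)
    simp only [Prod.mk_add_mk, add_zero, zero_add] at A
    rw [inv3 g h k] at A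
    linear_combination (norm := module) A) (fun g => n2 _ _) (fun g => n1 _ _) two sq
  obtain ⟨ν, hν⟩ := hP (fun a b c => w (a, 0) (b, 0) (c, 0))
    (fun g h k l => by simpa using hw (g, 0) (h, 0) (k, 0) (l, 0)) (fun g => hI (g, 0))
  refine ⟨fun g k => ν g.1 k.1 + if k.2 = 0 then 0 else m g.1, ?_⟩
  rintro ⟨a, i⟩ ⟨b, j⟩ ⟨c, k⟩
  rw [inv, inv2]
  have e1 := hν a b c
  have e2 := hp a b
  have e3 := inv3 a b c
  have m1 := hm a
  simp only [d2] at e1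
  rcases z2 j with rfl | rfl <;> rcases z2 k with rfl | rfl <;>
    simp only [d2, z11, Prod.mk_add_mk, add_zero, zero_add, if_true, one_ne_zero, if_false]
  · exact e1
  · linear_combination (norm := module) e1 + e2 + e3
  · linear_combination (norm := module) e1
  · linear_combination (norm := module) e1 + e2 + e3 + m1

theorem P_step (hA : ∀ a : A, a + a = 0) (hdiv : ∀ x : M, ∃ y, y + y = x)
    (hQ : Q A M) (hP : P A M) : P (A × ZMod 2) M := by
  have hA' : ∀ a : A × ZMod 2, a + a = 0 := by
    rintro ⟨a, i⟩
    rcases z2 i with rfl | rfl <;> simp [hA, z11]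
  intro w hw hI
  obtain ⟨ν, hn⟩ := normalize hw
  apply reduce ν
  replace hw := C3_sub hw ν
  replace hI := I0_sub hA' hI ν
  change ∃ ν', ∀ g h k, (fun g h k => w g h k - d2 ν g h k) g h k = d2 ν' g h k
  generalize (fun g h k => w g h k - d2 ν g h k) = w1 at hw hn hI
  clear ν w
  obtain ⟨ν, u1, u2, u3⟩ := step1 w1 hw hn hI
  apply reduce ν
  replace hw := C3_sub hw ν
  replace hI := I0_sub hA' hI ν
  replace hn := N3_sub hn ν u1 u2
  have k1 : ∀ h k, (fun g h k => w1 g h k - d2 ν g h k) (0, 1) h k = 0 :=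
    fun h k => sub_eq_zero.2 (u3 h k)
  change ∃ ν', ∀ g h k, (fun g h k => w1 g h k - d2 ν g h k) g h k = d2 ν' g h k
  generalize (fun g h k => w1 g h k - d2 ν g h k) = w2 at hw hn hI k1
  clear u1 u2 u3 ν w1
  obtain ⟨ν, u1, u2, u3, u4⟩ := step2 hdiv w2 hw hn k1
  apply reduce ν
  replace hw := C3_sub hw ν
  replace hI := I0_sub hA' hI ν
  replace hn := N3_sub hn ν u1 u2
  have k1 : ∀ h k, (fun g h k => w2 g h k - d2 ν g h k) (0, 1) h k = 0 :=
    fun h k => by simp only [k1, u3, sub_zero]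
  have k2 : ∀ g k, (fun g h k => w2 g h k - d2 ν g h k) g (0, 1) k = 0 :=
    fun h k => sub_eq_zero.2 (u4 h k)
  exact step3 hQ hP _ hw hn hI k1 k2

theorem P_unit : P Unit M := by
  intro w hw hI
  refine ⟨fun _ _ => w 0 0 0, fun g h k => ?_⟩
  have := hw 0 0 0 0
  simp only [add_zero] at this
  have e : ∀ x : Unit, x = 0 := fun x => rfl
  simp only [d2, e g, e h, e k]
  linear_combination (norm := module) this

theorem Q_unit : Q Unit M := by
  intro p hc n1 n2 h2 hs
  exact ⟨fun _ => 0, fun _ => add_zero 0, fun g h => by simpa using n1 g⟩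

theorem P_three (hdiv : ∀ x : M, ∃ y, y + y = x) :
    P (((Unit × ZMod 2) × ZMod 2) × ZMod 2) M := by
  have h0 : ∀ a : Unit, a + a = 0 := by decide
  have h1 : ∀ a : Unit × ZMod 2, a + a = 0 := by decide
  have h2 : ∀ a : (Unit × ZMod 2) × ZMod 2, a + a = 0 := by decide
  exact P_step h2 hdiv (Q_step h1 (Q_step h0 Q_unit))
    (P_step h1 hdiv (Q_step h0 Q_unit) (P_step h0 hdiv Q_unit P_unit))

theorem P_equiv (e : A ≃+ B) (h : P A M) : P B M := by
  intro w hw hI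
  obtain ⟨ν, hν⟩ := h (fun a b c => w (e a) (e b) (e c))
    (fun g h k l => by simpa using hw (e g) (e h) (e k) (e l))
    (fun g => by simpa using hI (e g))
  refine ⟨fun a b => ν (e.symm a) (e.symm b), fun g h k => ?_⟩
  simpa [d2] using hν (e.symm g) (e.symm h) (e.symm k)

/-- the iterated product is the function space -/
def eqv : (((Unit × ZMod 2) × ZMod 2) × ZMod 2) ≃+ (Fin 3 → ZMod 2) where
  toFun x := ![x.1.1.2, x.1.2, x.2]
  invFun f := ((((), f 0), f 1), f 2)
  left_inv := by rintro ⟨⟨⟨_, a⟩, b⟩, c⟩; rfl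
  right_inv f := by ext i; fin_cases i <;> rfl
  map_add' x y := by ext i; fin_cases i <;> rfl

theorem P_main (hdiv : ∀ x : M, ∃ y, y + y = x) : P (Fin 3 → ZMod 2) M :=
  P_equiv eqv (P_three hdiv)

end EH3

namespace EH3

/-- the vector space -/
abbrev V := Fin 3 → ZMod 2

/-- the group -/
abbrev G8 := Multiplicative V

theorem hdiv_units (x : Additive ℂˣ) : ∃ y, y + y = x := by
  obtain ⟨z, hz⟩ := IsAlgClosed.exists_pow_nat_eq (k := ℂ) (x.toMul : ℂ) (n := 2) (by norm_num)
  have hz0 : z ≠ 0 := by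
    rintro rfl
    have := x.toMul.ne_zero
    apply this
    rw [← hz]
    norm_num
  refine ⟨Additive.ofMul (Units.mk0 z hz0), ?_⟩
  apply Additive.toMul.injective
  apply Units.ext
  simp [← hz, sq]

/-- restriction to the cyclic subgroup generated by `g` -/
def Inv (ω : G8 → G8 → G8 → ℂˣ) (g : G8) : ℂˣ := ω g g g * ω g 1 g

theorem two_torsion (g : G8) : g * g = 1 := by
  revert g
  change ∀ g : V, g + g = 0
  decide

theorem coboundary_of_Inv {ω : G8 → G8 → G8 → ℂˣ} (h : IsThreeCocycle ω)
    (hI : ∀ g, Inv ω g = 1) : IsThreeCoboundary ω := by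
  obtain ⟨ν, hν⟩ := P_main (M := Additive ℂˣ) hdiv_units
    (fun a b c => Additive.ofMul (ω (.ofAdd a) (.ofAdd b) (.ofAdd c)))
    (fun a b c d => congrArg Additive.ofMul (h (.ofAdd a) (.ofAdd b) (.ofAdd c) (.ofAdd d)))
    (fun a => congrArg Additive.ofMul (hI (.ofAdd a)))
  refine ⟨fun a b => (ν a.toAdd b.toAdd).toMul, fun g h k => ?_⟩
  have := congrArg Additive.toMul (hν g.toAdd h.toAdd k.toAdd)
  simpa [d2, div_eq_mul_inv] using this

theorem Inv_coboundary {ω : G8 → G8 → G8 → ℂˣ} (h : IsThreeCoboundary ω) (g : G8) :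
    Inv ω g = 1 := by
  obtain ⟨ν, hν⟩ := h
  simp only [Inv, hν, two_torsion, mul_one, one_mul]
  apply Additive.ofMul.injective
  simp only [ofMul_mul, ofMul_inv, ofMul_one]
  abel

theorem Inv_sq {ω : G8 → G8 → G8 → ℂˣ} (h : IsThreeCocycle ω) (g : G8) :
    Inv ω g * Inv ω g = 1 := by
  have A := congrArg Additive.ofMul (h g g g g)
  have B := congrArg Additive.ofMul (h g 1 1 g)
  have C := congrArg Additive.ofMul (h 1 1 g g)
  have D := congrArg Additive.ofMul (h g g 1 1)
  have E := congrArg Additive.ofMul (h 1 1 1 1)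
  apply Additive.ofMul.injective
  simp only [Inv, two_torsion, mul_one, one_mul, ofMul_mul, ofMul_one] at *
  linear_combination (norm := module) A - B + C + D + (2 : ℤ) • E

/-- support of the invariant -/
noncomputable def Sup (ω : G8 → G8 → G8 → ℂˣ) (v : V) : Bool :=
  open Classical in decide (Inv ω (.ofAdd v) ≠ 1)

theorem Inv_cases {ω : G8 → G8 → G8 → ℂˣ} (h : IsThreeCocycle ω) (g : G8) :
    Inv ω g = 1 ∨ Inv ω g = -1 := by
  have := Inv_sq h g
  have h2 : ((Inv ω g : ℂˣ) : ℂ) * (Inv ω g : ℂˣ) = 1 := by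
    rw [← Units.val_mul, this, Units.val_one]
  rcases mul_self_eq_one_iff.1 h2 with h3 | h3
  · left; exact Units.ext h3
  · right; exact Units.ext (by simpa using h3)

theorem rel_iff (a b : {ω : G8 → G8 → G8 → ℂˣ // IsThreeCocycle ω}) :
    AutCohomologousRel a b ↔
      ∃ φ : G8 ≃* G8, ∀ v : V, Sup a.1 (φ (.ofAdd v)).toAdd = Sup b.1 v := by
  have key : ∀ φ : G8 ≃* G8, ∀ g : G8,
      Inv (fun g h k => a.1 (φ g) (φ h) (φ k) * (b.1 g h k)⁻¹) g =
        Inv a.1 (φ g) * (Inv b.1 g)⁻¹ := by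
    intro φ g
    simp only [Inv, map_one, mul_inv]
    exact mul_mul_mul_comm _ _ _ _
  constructor
  · rintro ⟨φ, hφ⟩
    refine ⟨φ, fun v => ?_⟩
    have := Inv_coboundary hφ (.ofAdd v)
    rw [key, mul_inv_eq_one] at this
    simp only [Sup, ofAdd_toAdd, this]
  · rintro ⟨φ, hφ⟩
    refine ⟨φ, coboundary_of_Inv ?_ ?_⟩
    · intro g h k l
      have A := congrArg Additive.ofMul (a.2 (φ g) (φ h) (φ k) (φ l))
      have B := congrArg Additive.ofMul (b.2 g h k l)
      apply Additive.ofMul.injective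
      simp only [map_mul, ofMul_mul, ofMul_inv] at *
      linear_combination (norm := module) A - B
    · intro g
      rw [key, mul_inv_eq_one]
      have := hφ g.toAdd
      simp only [Sup, ofAdd_toAdd, decide_eq_decide] at this
      rcases Inv_cases a.2 (φ g) with h1 | h1 <;> rcases Inv_cases b.2 g with h2 | h2 <;>
        simp_all

/-- orbit invariant -/
def code (f : V → Bool) : ℕ × Bool :=
  (∑ v, (f v).toNat, decide ((∑ v, if f v then v else 0) = 0))

theorem code_comp (f : V → Bool) (φ : G8 ≃* G8) :
    code (fun v => f (φ (.ofAdd v)).toAdd) = code f := by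
  let e : V ≃+ V := MulEquiv.toAdditive φ
  have he : ∀ v, (φ (.ofAdd v)).toAdd = e v := fun v => rfl
  simp only [he, code]
  refine Prod.ext (Equiv.sum_comp e.toEquiv (fun v => (f v).toNat)) ?_
  simp only [decide_eq_decide]
  have : (∑ v, if f v then v else 0) = e (∑ v, if f (e v) then v else 0) := by
    rw [map_sum, ← Equiv.sum_comp e.toEquiv (fun v => if f v then v else 0)]
    refine Finset.sum_congr rfl fun v _ => ?_
    by_cases h : f (e v) <;> simp [h]
  rw [this, map_eq_zero_iff e e.injective]

/-- the sign character -/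
def sgn (x : ZMod 2) : ℂˣ := if x = 0 then 1 else -1

theorem sgn_add (x y : ZMod 2) : sgn (x + y) = sgn x * sgn y := by
  rcases z2 x with rfl | rfl <;> rcases z2 y with rfl | rfl <;> simp [sgn, z11]

/-- coefficients -/
def cf (c s : ℕ) : ZMod 2 := if c.testBit s then 1 else 0

/-- trilinear forms -/
def T (c : ℕ) (g h k : V) : ZMod 2 :=
  cf c 1 * g 0 * h 0 * k 0 + cf c 2 * g 1 * h 1 * k 1 + cf c 3 * g 0 * h 0 * k 1 +
  cf c 4 * g 2 * h 2 * k 2 + cf c 5 * g 0 * h 0 * k 2 + cf c 6 * g 1 * h 1 * k 2 +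
  cf c 7 * g 0 * h 1 * k 2

/-- representing cocycles -/
def om (c : ℕ) : {ω : G8 → G8 → G8 → ℂˣ // IsThreeCocycle ω} :=
  ⟨fun g h k => sgn (T c g.toAdd h.toAdd k.toAdd), by
    intro g h k l
    simp only [← sgn_add, toAdd_mul, T, Pi.add_apply]
    congr 1
    ring⟩

theorem Sup_om (c : ℕ) (v : V) : Sup (om c).1 v = decide (T c v v v = 1) := by
  have h1 : T c v 0 v = 0 := by simp [T]
  have h2 : Inv (om c).1 (.ofAdd v) = sgn (T c v v v) := by
    change sgn (T c v v v) * sgn (T c v 0 v) = _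
    rw [h1]
    simp [sgn]
  simp only [Sup, h2, decide_eq_decide]
  have h3 : (-1 : ℂˣ) ≠ 1 := by
    intro h
    have := congrArg Units.val h
    norm_num at this
  rcases z2 (T c v v v) with h | h <;> simp [h, sgn, h3]

/-- coefficients of the ten representatives -/
def reps : List ℕ := [0, 170, 102, 238, 150, 30, 22, 190, 126, 254]

/-- supports of the ten representatives -/
def masks : List ℕ := [0, 2, 6, 14, 22, 30, 150, 62, 126, 254]

/-- vector with given bits -/
def dec (n : ℕ) : V := ![cf n 0, cf n 1, cf n 2]

/-- linear combination -/
def comb (u v w n : ℕ) : ℕ :=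
  (cond (n.testBit 0) u 0) ^^^ (cond (n.testBit 1) v 0) ^^^ (cond (n.testBit 2) w 0)

theorem cf_xor (m n s : ℕ) : cf (m ^^^ n) s = cf m s + cf n s := by
  simp only [cf, Nat.testBit_xor]
  cases m.testBit s <;> cases n.testBit s <;> simp [z11]

theorem dec_xor (m n : ℕ) : dec (m ^^^ n) = dec m + dec n := by
  ext i
  fin_cases i <;> simp [dec, cf_xor]

theorem dec_cond (n s u : ℕ) : dec (cond (n.testBit s) u 0) = cf n s • dec u := by
  unfold cf
  cases n.testBit s
  · ext i
    fin_cases i <;> simp [dec, cf]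
  · simp

/-- the linear map with given images of basis vectors -/
def lin (u v w : ℕ) : V →+ V where
  toFun x := x 0 • dec u + x 1 • dec v + x 2 • dec w
  map_zero' := by simp
  map_add' x y := by
    simp only [Pi.add_apply, add_smul]
    abel

theorem lin_dec (u v w n : ℕ) : lin u v w (dec n) = dec (comb u v w n) := by
  simp only [comb, dec_xor, dec_cond]
  rfl

theorem dec_surj : ∀ x : V, ∃ n < 8, dec n = x := by decide +kernel

/-- search for an equivalence with a representative -/
def chk (g : ℕ → Bool) (m : ℕ) : Bool :=
  [1, 2, 3, 4, 5, 6, 7].any fun u => [1, 2, 3, 4, 5, 6, 7].any fun v =>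
    [1, 2, 3, 4, 5, 6, 7].any fun w =>
      ([0, 1, 2, 3, 4, 5, 6, 7].all fun n => g (comb u v w n) == m.testBit n) &&
      ([1, 2, 3, 4, 5, 6, 7].all fun n => (comb u v w n).ble 7 && !(comb u v w n).beq 0)

/-- function with given values -/
def fn (b1 b2 b3 b4 b5 b6 b7 : Bool) (n : ℕ) : Bool :=
  (n.beq 1 && b1) || (n.beq 2 && b2) || (n.beq 3 && b3) || (n.beq 4 && b4) ||
    (n.beq 5 && b5) || (n.beq 6 && b6) || (n.beq 7 && b7)

/-- index of the representative for given values, found by trial -/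
def cnt (b1 b2 b3 b4 b5 b6 b7 : Bool) : ℕ :=
  b1.toNat + b2.toNat + b3.toNat + b4.toNat + b5.toNat + b6.toNat + b7.toNat

/-- candidates by size -/
def cand (n : ℕ) : List ℕ :=
  if n.beq 3 then [3, 4] else if n.beq 4 then [5, 6] else if n.ble 2 then [n] else [n + 2]

theorem chk_all : ∀ b1 b2 b3 b4 b5 b6 b7 : Bool,
    ((cand (cnt b1 b2 b3 b4 b5 b6 b7)).any fun i => i.blt 10 &&
      chk (fn b1 b2 b3 b4 b5 b6 b7) (masks.getD i 0)) = true := by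
  decide +kernel

theorem masks_reps : ∀ i < 10, ∀ n < 8,
    decide (T (reps.getD i 0) (dec n) (dec n) (dec n) = 1) = (masks.getD i 0).testBit n := by
  decide +kernel

theorem beq_decide (a b : ℕ) : Nat.beq a b = decide (a = b) := by
  rw [Bool.eq_iff_iff]
  simp

theorem exists_equiv (f : V → Bool) (h0 : f 0 = false) :
    ∃ i < 10, ∃ φ : G8 ≃* G8, ∀ v : V,
      f (φ (.ofAdd v)).toAdd = Sup (om (reps.getD i 0)).1 v := by
  have hf : ∀ n < 8, f (dec n) = fn (f (dec 1)) (f (dec 2)) (f (dec 3)) (f (dec 4)) (f (dec 5))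
      (f (dec 6)) (f (dec 7)) n := by
    have hd : f (dec 0) = false := by
      rw [← h0]; congr 1; decide
    intro n hn
    interval_cases n <;> simp [fn, hd, beq_decide]
  have := chk_all (f (dec 1)) (f (dec 2)) (f (dec 3)) (f (dec 4)) (f (dec 5))
      (f (dec 6)) (f (dec 7))
  generalize fn (f (dec 1)) (f (dec 2)) (f (dec 3)) (f (dec 4)) (f (dec 5))
      (f (dec 6)) (f (dec 7)) = g at hf this
  rw [List.any_eq_true] at this
  obtain ⟨i, -, hi⟩ := this
  rw [Bool.and_eq_true] at hi
  obtain ⟨hi, hc⟩ := hi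
  have hi : i < 10 := by simpa [Nat.blt_eq] using hi
  refine ⟨i, hi, ?_⟩
  simp only [chk, List.any_eq_true] at hc
  obtain ⟨u, -, v, -, w, -, hc⟩ := hc
  rw [Bool.and_eq_true, List.all_eq_true, List.all_eq_true] at hc
  obtain ⟨c1, c2⟩ := hc
  have c1' : ∀ n < 8, g (comb u v w n) = (masks.getD i 0).testBit n := by
    intro n hn
    have := c1 n (by interval_cases n <;> simp)
    simpa using this
  have c2' : ∀ n < 8, comb u v w n < 8 ∧ (comb u v w n = 0 → n = 0) := by
    intro n hn
    by_cases hn0 : n = 0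
    · subst hn0
      simp [comb]
    · have := c2 n (by interval_cases n <;> simp_all)
      simp only [Bool.and_eq_true, Nat.ble_eq, Bool.not_eq_true', beq_decide,
        decide_eq_false_iff_not] at this
      exact ⟨by omega, fun h => absurd h this.2⟩
  have dz : ∀ n < 8, dec n = 0 → n = 0 := by decide +kernel
  have inj : Function.Injective (lin u v w) := by
    rw [injective_iff_map_eq_zero]
    intro x hx
    obtain ⟨n, hn, rfl⟩ := dec_surj x
    rw [lin_dec] at hx
    have := (c2' n hn).2 (dz _ (c2' n hn).1 hx)
    subst this
    decide
  have bij : Function.Bijective (lin u v w) := Finite.injective_iff_bijective.1 inj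
  refine ⟨AddEquiv.toMultiplicative (AddEquiv.ofBijective (lin u v w) bij), fun x => ?_⟩
  obtain ⟨n, hn, rfl⟩ := dec_surj x
  change f (lin u v w (dec n)) = _
  rw [lin_dec, hf _ (c2' n hn).1, c1' n hn, Sup_om, masks_reps i hi n hn]

theorem code_inj : ∀ i j : Fin 10,
    code (fun v => decide (T (reps.getD i 0) v v v = 1)) =
      code (fun v => decide (T (reps.getD j 0) v v v = 1)) → i = j := by
  decide +kernel

theorem Sup_zero (a : {ω : G8 → G8 → G8 → ℂˣ // IsThreeCocycle ω}) : Sup a.1 0 = false := by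
  have h := a.2 1 1 1 1
  simp only [mul_one, mul_eq_left] at h
  have : Inv a.1 1 = 1 := by simp [Inv, h]
  simpa [Sup] using this

end EH3

theorem card_orbits_autAction_H3_elementaryAbelian_eight :
    Nat.card
      (Quot (AutCohomologousRel (G := Multiplicative (Fin 3 → ZMod 2)))) = 10 := by
  have bij : Function.Bijective (fun i : Fin 10 =>
      Quot.mk (AutCohomologousRel (G := Multiplicative (Fin 3 → ZMod 2)))
        (EH3.om (EH3.reps.getD i 0))) := by
    constructor
    · intro i j hij
      let F : Quot (AutCohomologousRel (G := Multiplicative (Fin 3 → ZMod 2))) → ℕ × Bool :=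
        Quot.lift (fun a => EH3.code (EH3.Sup a.1)) (by
          intro a b hab
          obtain ⟨φ, hφ⟩ := (EH3.rel_iff a b).1 hab
          rw [← EH3.code_comp (EH3.Sup a.1) φ]
          congr 1
          exact funext hφ)
      have := congrArg F hij
      apply EH3.code_inj
      simp only [← EH3.Sup_om]
      exact this
    · intro q
      induction q using Quot.ind with
      | mk a =>
        obtain ⟨i, hi, h⟩ := EH3.exists_equiv (EH3.Sup a.1) (EH3.Sup_zero a)
        exact ⟨⟨i, hi⟩, (Quot.sound ((EH3.rel_iff _ _).2 h)).symm⟩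
  rw [← Nat.card_congr (Equiv.ofBijective _ bij)]
  simp
end
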